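/- Let μ ∈ ℳ, let σ ∈ S_k be a pattern, and let δ ∈ (t_σ(μ), α_σ(μ)) be such that the function G(σ,μ,·) is right-continuous at δ. Then, conditioned on the event {t_σ(π_{n,μ}) ≥ δ}, the Lévy–Prokhorov distance from Em(π_{n,μ}) to the set 𝒪(𝒢(σ,μ,δ)) := {𝒪(ν) : ν ∈ 𝒢(σ,μ,δ)} converges to 0 in probability: for every ε > 0, P({d_LP(Em(π_{n,μ}), 𝒪(𝒢(σ,μ,δ))) ≥ ε} ∩ {t_σ(π_{n,μ}) ≥ δ}) / P(t_σ(π_{n,μ}) ≥ δ) → 0 as n → ∞. -/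

import Mathlib

open MeasureTheory Filter Topology
open scoped ENNReal

noncomputable section

/-- The plane `ℝ²`, carrier for measures on the unit square. -/
abbrev Ω2 : Type := ℝ × ℝ

/-- The unit square `[0,1]² ⊆ ℝ²`. -/
def unitSq : Set Ω2 := Set.Icc (0 : ℝ) 1 ×ˢ Set.Icc (0 : ℝ) 1

/-- Lebesgue measure on the unit square. -/
def lebSq : Measure Ω2 := volume.restrict unitSq

/-- `𝒫`: Borel probability measures concentrated on the unit square. -/
def Pcal : Set (ProbabilityMeasure Ω2) := {μ | (μ : Measure Ω2) unitSq = 1}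

/-- `ℳ`: members of `𝒫` whose two coordinate marginals are atomless
(equivalently, have continuous CDFs). -/
def Mcal : Set (ProbabilityMeasure Ω2) :=
  {μ | μ ∈ Pcal ∧ (∀ x : ℝ, (μ : Measure Ω2).map Prod.fst {x} = 0) ∧
      ∀ y : ℝ, (μ : Measure Ω2).map Prod.snd {y} = 0}

/-- The uniform distribution on `[0,1]`. -/
def unif01 : Measure ℝ := volume.restrict (Set.Icc (0 : ℝ) 1)

/-- `ℳ̃`: permutons, i.e. members of `𝒫` with both marginals uniform on `[0,1]`. -/
def Mtilde : Set (ProbabilityMeasure Ω2) :=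
  {μ | μ ∈ Pcal ∧ (μ : Measure Ω2).map Prod.fst = unif01 ∧
      (μ : Measure Ω2).map Prod.snd = unif01}

open scoped Classical in
/-- `h_σ`: indicator that the `k` points induce the pattern `σ`. -/
def hPat {k : ℕ} (σ : Equiv.Perm (Fin k)) (z : Fin k → Ω2) : ℝ :=
  if ∃ τ : Equiv.Perm (Fin k),
      StrictMono (fun i => (z (τ i)).1) ∧ StrictMono (fun i => (z (τ (σ⁻¹ i))).2)
  then 1 else 0

/-- Pattern density `t_σ(ν) = ∫ h_σ dν^{⊗k}`. -/
def tPat {k : ℕ} (σ : Equiv.Perm (Fin k)) (ν : Measure Ω2) : ℝ :=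
  ∫ z, hPat σ z ∂(Measure.pi fun _ : Fin k => ν)

open scoped Classical in
/-- The permutation induced by `n` labelled points of `ℝ²` (junk value `1` if the
coordinates are not in generic position). -/
def inducedPerm {n : ℕ} (z : Fin n → Ω2) : Equiv.Perm (Fin n) :=
  if h : ∃ σ : Equiv.Perm (Fin n), hPat σ z = 1 then h.choose else 1

/-- Empirical measure `Em(π) = (1/n) ∑ δ_{(i/n, π(i)/n)}` of a permutation, as a measure. -/
def EmM {n : ℕ} (π : Equiv.Perm (Fin n)) : Measure Ω2 :=
  (n : ℝ≥0∞)⁻¹ • ∑ i : Fin n, Measure.dirac ((((i : ℕ) + 1 : ℝ)) / n, (((π i : ℕ) + 1 : ℝ)) / n)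

open scoped Classical in
/-- Empirical measure of a permutation as a probability measure (junk value for `n = 0`). -/
def EmP {n : ℕ} (π : Equiv.Perm (Fin n)) : ProbabilityMeasure Ω2 :=
  if h : IsProbabilityMeasure (EmM π) then ⟨EmM π, h⟩
  else ⟨Measure.dirac 0, by infer_instance⟩

/-- `t_σ(π) := t_σ(Em(π))`. -/
def tPerm {k n : ℕ} (σ : Equiv.Perm (Fin k)) (π : Equiv.Perm (Fin n)) : ℝ := tPat σ (EmM π)

open scoped Classical in
/-- Kullback–Leibler divergence `D(ν|μ) ∈ [0,∞]`; for probability measures with `ν ≪ μ`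
it equals `∫ log(dν/dμ) dν`, written here through the nonnegative integrand
`g log g + 1 - g` of the density `g = dν/dμ` (the correction `∫ (1-g) dμ = 0`). -/
def KL (ν μ : Measure Ω2) : ℝ≥0∞ :=
  if ν ≪ μ then
    ∫⁻ z, ENNReal.ofReal ((ν.rnDeriv μ z).toReal * Real.log ((ν.rnDeriv μ z).toReal)
      + 1 - (ν.rnDeriv μ z).toReal) ∂μ
  else ∞

/-- CDF of the first marginal. -/
def cdfX (μ : Measure Ω2) (x : ℝ) : ℝ := (μ {p : Ω2 | p.1 ≤ x}).toReal

/-- CDF of the second marginal. -/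
def cdfY (μ : Measure Ω2) (y : ℝ) : ℝ := (μ {p : Ω2 | p.2 ≤ y}).toReal

/-- The map `𝒪`: pushforward of `μ` under `(x,y) ↦ (F₁(x), F₂(y))`. -/
def Omap (μ : Measure Ω2) : Measure Ω2 := μ.map fun p => (cdfX μ p.1, cdfY μ p.2)

/-- The product measure `μ^{⊗n}` governing `n` i.i.d. samples. -/
def pmeas (μ : Measure Ω2) (n : ℕ) : Measure (Fin n → Ω2) := Measure.pi fun _ => μ

/-- Log-partition function `F_n(σ,μ,θ) = log E[exp(nθ t_σ(π_{n,μ}))]`. -/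
def Fn {k : ℕ} (σ : Equiv.Perm (Fin k)) (μ : Measure Ω2) (θ : ℝ) (n : ℕ) : ℝ :=
  Real.log (∫ z, Real.exp (n * θ * tPerm σ (inducedPerm z)) ∂pmeas μ n)

/-- The Gibbs measure `Q_{n,σ,μ,θ}` on `([0,1]²)ⁿ`. -/
def Qgibbs {k : ℕ} (σ : Equiv.Perm (Fin k)) (μ : Measure Ω2) (θ : ℝ) (n : ℕ) :
    Measure (Fin n → Ω2) :=
  (pmeas μ n).withDensity fun z =>
    ENNReal.ofReal (Real.exp (n * θ * tPerm σ (inducedPerm z) - Fn σ μ θ n))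

/-- `F(σ,μ,θ) = sup_{ν ∈ ℳ} { θ t_σ(ν) − D(ν|μ) }`, valued in `EReal`. -/
def Fsup {k : ℕ} (σ : Equiv.Perm (Fin k)) (μ : Measure Ω2) (θ : ℝ) : EReal :=
  ⨆ ν ∈ Mcal, (((θ * tPat σ (ν : Measure Ω2) : ℝ) : EReal) - ((KL (↑ν) μ : ℝ≥0∞) : EReal))

/-- `ℱ(σ,μ,θ)`: the set of maximizers of `ν ↦ θ t_σ(ν) − D(ν|μ)` over `ℳ`. -/
def Fset {k : ℕ} (σ : Equiv.Perm (Fin k)) (μ : Measure Ω2) (θ : ℝ) :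
    Set (ProbabilityMeasure Ω2) :=
  {ν | ν ∈ Mcal ∧
    (((θ * tPat σ (ν : Measure Ω2) : ℝ) : EReal) - ((KL (↑ν) μ : ℝ≥0∞) : EReal)) = Fsup σ μ θ}

/-- `G(σ,μ,δ) = inf { D(ν|μ) : ν ∈ ℳ, t_σ(ν) ≥ δ }`. -/
def Gfun {k : ℕ} (σ : Equiv.Perm (Fin k)) (μ : Measure Ω2) (δ : ℝ) : ℝ≥0∞ :=
  ⨅ ν ∈ {ν : ProbabilityMeasure Ω2 | ν ∈ Mcal ∧ δ ≤ tPat σ (ν : Measure Ω2)}, KL (↑ν) μ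

/-- `𝒢(σ,μ,δ)`: the set of minimizers in the definition of `G(σ,μ,δ)`. -/
def Gset {k : ℕ} (σ : Equiv.Perm (Fin k)) (μ : Measure Ω2) (δ : ℝ) :
    Set (ProbabilityMeasure Ω2) :=
  {ν | (ν ∈ Mcal ∧ δ ≤ tPat σ (ν : Measure Ω2)) ∧ KL (↑ν) μ = Gfun σ μ δ}

/-- `α_σ(μ) = inf {δ : G(σ,μ,δ) = ∞}`. -/
def alphaSig {k : ℕ} (σ : Equiv.Perm (Fin k)) (μ : Measure Ω2) : ℝ :=
  sInf {δ : ℝ | Gfun σ μ δ = ∞}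

/-- `μ` is conditionally constant (CC) with respect to a pattern `σ` of size `k+1`:
the conditional probability `P(π_{X,Y} = σ | (X₁,Y₁))`, which for i.i.d. samples equals
`z ↦ ∫ h_σ(z, w) dμ^{⊗k}(w)`, is `μ`-a.s. equal to a constant `c ∈ [0,1]`. -/
def IsCC {k : ℕ} (σ : Equiv.Perm (Fin (k + 1))) (μ : Measure Ω2) : Prop :=
  ∃ c ∈ Set.Icc (0 : ℝ) 1, ∀ᵐ z ∂μ,
    (∫ w : Fin k → Ω2, hPat σ (Fin.cons z w) ∂pmeas μ k) = c

/-- The inversion pattern `21 ∈ S₂`. -/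
def inv2 : Equiv.Perm (Fin 2) := Equiv.swap 0 1

/-- Lévy–Prokhorov (extended) distance between measures on `ℝ²`. -/
def dLPE (μ ν : Measure Ω2) : ℝ≥0∞ := levyProkhorovEDist μ ν

/-- The topological support of a measure: the points whose every open neighbourhood
has positive measure. -/
def msupport (μ : Measure Ω2) : Set Ω2 :=
  {z | ∀ U : Set Ω2, IsOpen U → z ∈ U → 0 < μ U}

/-! ### Empirical measures of finite configurations -/

/-- The empirical measure `(1/n) ∑ δ_{w i}` of a finite configuration of points. -/
def emp {n : ℕ} (w : Fin n → Ω2) : Measure Ω2 :=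
  (n : ℝ≥0∞)⁻¹ • ∑ i : Fin n, Measure.dirac (w i)

lemma isProbabilityMeasure_emp {n : ℕ} (hn : 0 < n) (w : Fin n → Ω2) :
    IsProbabilityMeasure (emp w) := by
  constructor
  have : (n : ℝ≥0∞) ≠ 0 := by exact_mod_cast hn.ne'
  simp [emp, ENNReal.inv_mul_cancel this]

lemma emp_eq_map {n : ℕ} (w : Fin n → Ω2) :
    emp w = ((n : ℝ≥0∞)⁻¹ • (Measure.count : Measure (Fin n))).map w := by
  rw [Measure.map_smul, Measure.count, Measure.sum_fintype,
    Measure.map_finset_sum (measurable_of_finite w).aemeasurable]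
  simp [emp, Measure.map_dirac]

lemma emp_comp_perm {n : ℕ} (w : Fin n → Ω2) (τ : Equiv.Perm (Fin n)) : emp (w ∘ τ) = emp w := by
  simp only [emp, Function.comp]
  rw [Equiv.sum_comp τ (fun i => Measure.dirac (w i))]

lemma map_emp {n : ℕ} (w : Fin n → Ω2) {T : Ω2 → Ω2} (hT : Measurable T) :
    (emp w).map T = emp (T ∘ w) := by
  rw [emp, Measure.map_smul, Measure.map_finset_sum hT.aemeasurable]
  simp [emp, Measure.map_dirac' hT]

lemma integral_emp {n : ℕ} (w : Fin n → Ω2) {f : Ω2 → ℝ} :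
    ∫ x, f x ∂(emp w) = (∑ i, f (w i)) / n := by
  rw [emp, integral_smul_measure, integral_finsetSum_measure]
  · simp [integral_dirac, div_eq_inv_mul]
  · intro i _
    exact integrable_dirac (by simp)

lemma measurable_hPat {k : ℕ} (σ : Equiv.Perm (Fin k)) : Measurable (hPat σ) := by
  unfold hPat
  refine Measurable.ite ?_ measurable_const measurable_const
  have : {z : Fin k → Ω2 | ∃ τ : Equiv.Perm (Fin k),
      StrictMono (fun i => (z (τ i)).1) ∧ StrictMono (fun i => (z (τ (σ⁻¹ i))).2)} =
      ⋃ τ : Equiv.Perm (Fin k), ⋂ i, ⋂ j, ⋂ (_ : i < j),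
        ({z | (z (τ i)).1 < (z (τ j)).1} ∩ {z | (z (τ (σ⁻¹ i))).2 < (z (τ (σ⁻¹ j))).2}) := by
    ext z
    simp only [Set.mem_ofPred_eq, Set.mem_iUnion, Set.mem_iInter, Set.mem_inter_iff, StrictMono]
    exact exists_congr fun τ => ⟨fun h i j hij => ⟨h.1 hij, h.2 hij⟩,
      fun h => ⟨fun i j hij => (h i j hij).1, fun i j hij => (h i j hij).2⟩⟩
  rw [this]
  refine MeasurableSet.iUnion fun τ => MeasurableSet.iInter fun i => MeasurableSet.iInter fun j =>
    MeasurableSet.iInter fun _ => MeasurableSet.inter ?_ ?_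
  · exact measurableSet_lt (by fun_prop) (by fun_prop)
  · exact measurableSet_lt (by fun_prop) (by fun_prop)

lemma hPat_nonneg {k : ℕ} (σ : Equiv.Perm (Fin k)) (z : Fin k → Ω2) : 0 ≤ hPat σ z := by
  unfold hPat; split_ifs <;> norm_num

lemma hPat_le_one {k : ℕ} (σ : Equiv.Perm (Fin k)) (z : Fin k → Ω2) : hPat σ z ≤ 1 := by
  unfold hPat; split_ifs <;> norm_num

lemma integrable_hPat {k : ℕ} (σ : Equiv.Perm (Fin k)) (ν : Measure (Fin k → Ω2))
    [IsFiniteMeasure ν] : Integrable (hPat σ) ν :=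
  Integrable.of_bound (measurable_hPat σ).aestronglyMeasurable 1
    (Eventually.of_forall fun z => by
      rw [Real.norm_of_nonneg (hPat_nonneg σ z)]; exact hPat_le_one σ z)

lemma tPat_nonneg {k : ℕ} (σ : Equiv.Perm (Fin k)) (ν : Measure Ω2) : 0 ≤ tPat σ ν :=
  integral_nonneg fun z => hPat_nonneg σ z

lemma tPat_le_one {k : ℕ} (σ : Equiv.Perm (Fin k)) (ν : Measure Ω2) [IsProbabilityMeasure ν] :
    tPat σ ν ≤ 1 := by
  have := integral_mono (integrable_hPat σ (Measure.pi fun _ : Fin k => ν))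
    (integrable_const (1 : ℝ)) (hPat_le_one σ)
  simpa [tPat] using this

lemma tPat_emp {k n : ℕ} (hn : 0 < n) (σ : Equiv.Perm (Fin k)) (w : Fin n → Ω2) :
    tPat σ (emp w) = (∑ φ : Fin k → Fin n, hPat σ (w ∘ φ)) / n ^ k := by
  have hn' : (n : ℝ≥0∞) ≠ 0 := by exact_mod_cast hn.ne'
  have hP := isProbabilityMeasure_emp hn w
  have hU : IsProbabilityMeasure ((n : ℝ≥0∞)⁻¹ • (Measure.count : Measure (Fin n))) := by
    constructor
    simp [ENNReal.inv_mul_cancel hn']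
  rw [emp_eq_map] at hP
  rw [tPat, emp_eq_map, ← Measure.pi_map_pi (fun _ => (measurable_of_finite w).aemeasurable),
    integral_map (measurable_of_finite _).aemeasurable (measurable_hPat σ).aestronglyMeasurable,
    integral_fintype Integrable.of_finite]
  simp only [measureReal_def, Measure.pi_singleton]
  simp [Finset.mul_sum, div_eq_inv_mul, Function.comp_def]

lemma hPat_congr {k : ℕ} (σ : Equiv.Perm (Fin k)) {z z' : Fin k → Ω2}
    (h1 : ∀ i j, (z i).1 < (z j).1 ↔ (z' i).1 < (z' j).1)
    (h2 : ∀ i j, (z i).2 < (z j).2 ↔ (z' i).2 < (z' j).2) : hPat σ z = hPat σ z' := by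
  have (τ : Equiv.Perm (Fin k)) : (StrictMono (fun i => (z (τ i)).1) ∧
      StrictMono (fun i => (z (τ (σ⁻¹ i))).2)) ↔ (StrictMono (fun i => (z' (τ i)).1) ∧
      StrictMono (fun i => (z' (τ (σ⁻¹ i))).2)) := by
    simp only [StrictMono, h1, h2]
  classical
  simp only [hPat, exists_congr this]

/-- A configuration is generic if both families of coordinates are pairwise distinct. -/
def Generic {n : ℕ} (z : Fin n → Ω2) : Prop :=
  Function.Injective (fun i => (z i).1) ∧ Function.Injective (fun i => (z i).2)

lemma Generic.exists_hPat_eq_one {n : ℕ} {z : Fin n → Ω2} (hz : Generic z) :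
    ∃ σ : Equiv.Perm (Fin n), hPat σ z = 1 := by
  set τ := Tuple.sort (fun i => (z i).1)
  set ρ := Tuple.sort (fun i => (z i).2)
  refine ⟨ρ⁻¹ * τ, ?_⟩
  rw [hPat, if_pos]
  refine ⟨τ, ?_, ?_⟩
  · exact (Tuple.monotone_sort (fun i => (z i).1)).strictMono_of_injective
      (hz.1.comp τ.injective)
  · have : (fun i => (z (τ ((ρ⁻¹ * τ)⁻¹ i))).2) = (fun i => (z i).2) ∘ ρ := by
      ext i; simp
    rw [this]
    exact (Tuple.monotone_sort (fun i => (z i).2)).strictMono_of_injective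
      (hz.2.comp ρ.injective)

lemma Generic.exists_sort {n : ℕ} {z : Fin n → Ω2} (hz : Generic z) :
    ∃ τ : Equiv.Perm (Fin n), StrictMono (fun i => (z (τ i)).1) ∧
      StrictMono (fun i => (z (τ ((inducedPerm z)⁻¹ i))).2) := by
  have h := hz.exists_hPat_eq_one
  have h1 : hPat (inducedPerm z) z = 1 := by
    rw [inducedPerm, dif_pos h]
    exact h.choose_spec
  by_contra hc
  rw [hPat, if_neg hc] at h1
  exact zero_ne_one h1

lemma measurable_cdfX (μ : Measure Ω2) [IsFiniteMeasure μ] : Measurable (cdfX μ) :=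
  Monotone.measurable fun _ _ h => ENNReal.toReal_mono (measure_ne_top _ _)
    (measure_mono fun _ hp => le_trans (Set.mem_ofPred.1 hp) h)

lemma measurable_cdfY (μ : Measure Ω2) [IsFiniteMeasure μ] : Measurable (cdfY μ) :=
  Monotone.measurable fun _ _ h => ENNReal.toReal_mono (measure_ne_top _ _)
    (measure_mono fun _ hp => le_trans (Set.mem_ofPred.1 hp) h)

lemma measurable_cdfXY (μ : Measure Ω2) [IsFiniteMeasure μ] :
    Measurable fun p : Ω2 => (cdfX μ p.1, cdfY μ p.2) :=
  ((measurable_cdfX μ).comp measurable_fst).prodMk ((measurable_cdfY μ).comp measurable_snd)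

lemma emp_setOf_le {n : ℕ} (w : Fin n → Ω2) {u : Ω2 → ℝ} (hu : Measurable u)
    (τ : Equiv.Perm (Fin n)) (hτ : StrictMono fun i => u (w (τ i))) (i : Fin n) :
    (emp w {p | u p ≤ u (w (τ i))}).toReal = ((i : ℕ) + 1 : ℝ) / n := by
  have hm : MeasurableSet {p | u p ≤ u (w (τ i))} := measurableSet_le hu measurable_const
  rw [← emp_comp_perm w τ, emp, Measure.smul_apply, Measure.finsetSum_apply]
  simp only [Measure.dirac_apply' _ hm, Function.comp]
  have : ∀ j : Fin n, Set.indicator {p | u p ≤ u (w (τ i))} (1 : Ω2 → ℝ≥0∞) (w (τ j)) =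
      if j ≤ i then 1 else 0 := by
    intro j
    simp only [Set.indicator_apply, Set.mem_ofPred_eq, Pi.one_apply]
    congr 1
    exact propext hτ.le_iff_le
  simp only [this, Finset.sum_boole]
  have hc : (Finset.univ.filter fun j : Fin n => j ≤ i).card = (i : ℕ) + 1 := by
    have : (Finset.univ.filter fun j : Fin n => j ≤ i) = Finset.Iic i := by ext; simp
    rw [this, Fin.card_Iic]
  rw [hc]
  have : ((((i : ℕ) + 1 : ℕ) : ℝ≥0∞)).toReal = (i : ℕ) + 1 := by
    rw [ENNReal.toReal_natCast]; push_cast; rfl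
  rw [smul_eq_mul, ENNReal.toReal_mul, this]
  simp [div_eq_inv_mul]

/-- The rescaled graph points of a permutation. -/
def permPts {n : ℕ} (π : Equiv.Perm (Fin n)) (i : Fin n) : Ω2 :=
  ((((i : ℕ) + 1 : ℝ)) / n, (((π i : ℕ) + 1 : ℝ)) / n)

lemma EmM_eq_emp {n : ℕ} (π : Equiv.Perm (Fin n)) : EmM π = emp (permPts π) := rfl

lemma Generic.EmM_eq_Omap {n : ℕ} (hn : 0 < n) {z : Fin n → Ω2} (hz : Generic z) :
    EmM (inducedPerm z) = Omap (emp z) := by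
  obtain ⟨τ, h1, h2⟩ := hz.exists_sort
  have := isProbabilityMeasure_emp hn z
  rw [Omap, map_emp _ (measurable_cdfXY _), ← emp_comp_perm _ τ, EmM_eq_emp]
  congr 1
  ext i : 1
  have e1 := emp_setOf_le z measurable_fst τ h1 i
  have e2 := emp_setOf_le z measurable_snd (τ * (inducedPerm z)⁻¹) h2 (inducedPerm z i)
  have hinv : (τ * (inducedPerm z)⁻¹) (inducedPerm z i) = τ i := by simp
  rw [hinv] at e2
  simp only [permPts, Function.comp, cdfX, cdfY]
  rw [e1, e2]

lemma Generic.tPerm_eq {k n : ℕ} (hn : 0 < n) (σ : Equiv.Perm (Fin k)) {z : Fin n → Ω2}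
    (hz : Generic z) : tPerm σ (inducedPerm z) = tPat σ (emp z) := by
  obtain ⟨τ, h1, h2⟩ := hz.exists_sort
  have hn' : (0 : ℝ) < n := by exact_mod_cast hn
  rw [tPerm, EmM_eq_emp, ← emp_comp_perm z τ, tPat_emp hn, tPat_emp hn]
  congr 1
  refine Finset.sum_congr rfl fun φ _ => hPat_congr σ (fun i j => ?_) (fun i j => ?_)
  · simp only [Function.comp, permPts]
    rw [h1.lt_iff_lt, div_lt_div_iff_of_pos_right hn', add_lt_add_iff_right]
    norm_cast
  · simp only [Function.comp, permPts]
    have := h2.lt_iff_lt (a := inducedPerm z (φ i)) (b := inducedPerm z (φ j))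
    have hinv (j) : (inducedPerm z)⁻¹ (inducedPerm z j) = j := by simp
    simp only [hinv] at this
    rw [this, div_lt_div_iff_of_pos_right hn', add_lt_add_iff_right]
    norm_cast

/-! ### Product measures: genericity, exponential bounds and change of measure -/

instance isProbabilityMeasure_pmeas (μ : Measure Ω2) [IsProbabilityMeasure μ] (n : ℕ) :
    IsProbabilityMeasure (pmeas μ n) := by
  unfold pmeas; infer_instance

lemma lintegral_prod_pmeas (μ : Measure Ω2) [IsProbabilityMeasure μ] {n : ℕ}
    {f : Fin n → Ω2 → ℝ≥0∞} (hf : ∀ i, Measurable (f i)) :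
    ∫⁻ z, ∏ i, f i (z i) ∂pmeas μ n = ∏ i, ∫⁻ x, f i x ∂μ := by
  unfold pmeas
  refine (ProbabilityTheory.lintegral_prod_eq_prod_lintegral_of_indepFun Finset.univ
    (fun i (z : Fin n → Ω2) => f i (z i))
    (ProbabilityTheory.iIndepFun_pi fun i => (hf i).aemeasurable)
    (fun i => (hf i).comp (measurable_pi_apply i))).trans ?_
  refine Finset.prod_congr rfl fun i _ => ?_
  rw [← lintegral_map (hf i) (measurable_pi_apply i), (measurePreserving_eval _ i).map_eq]

lemma ae_eval_pmeas {μ : Measure Ω2} [IsProbabilityMeasure μ] {p : Ω2 → Prop} (hp : ∀ᵐ x ∂μ, p x)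
    (n : ℕ) : ∀ᵐ z ∂pmeas μ n, ∀ i, p (z i) :=
  ae_all_iff.2 fun i =>
    (Measure.quasiMeasurePreserving_eval (μ := fun _ : Fin n => μ) i).ae hp

lemma map_prodMk_pmeas (μ : Measure Ω2) [IsProbabilityMeasure μ] {n : ℕ} {i j : Fin n}
    (hij : i ≠ j) : (pmeas μ n).map (fun z => (z i, z j)) = μ.prod μ := by
  rw [pmeas, ← Measure.infinitePi_eq_pi]
  exact Measure.infinitePi_map_eval_prod (P := fun _ => μ) hij

lemma measure_setOf_eq_zero {μ : Measure Ω2} [IsProbabilityMeasure μ] {u : Ω2 → ℝ}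
    (hu : Measurable u) (h : ∀ x : ℝ, μ.map u {x} = 0) {n : ℕ} {i j : Fin n} (hij : i ≠ j) :
    pmeas μ n {z | u (z i) = u (z j)} = 0 := by
  have hm : MeasurableSet {p : Ω2 × Ω2 | u p.1 = u p.2} :=
    measurableSet_eq_fun (by fun_prop) (by fun_prop)
  have : pmeas μ n {z | u (z i) = u (z j)} = (μ.prod μ) {p : Ω2 × Ω2 | u p.1 = u p.2} := by
    rw [← map_prodMk_pmeas μ hij, Measure.map_apply (by fun_prop) hm]
    rfl
  rw [this, Measure.measure_prod_null hm]
  refine Eventually.of_forall fun x => ?_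
  have h2 := h (u x)
  rw [Measure.map_apply hu (measurableSet_singleton _)] at h2
  refine measure_mono_null (fun y hy => ?_) h2
  exact (Eq.symm hy : u y = u x)

lemma ae_generic {μ : ProbabilityMeasure Ω2} (hμ : μ ∈ Mcal) (n : ℕ) :
    ∀ᵐ z ∂pmeas μ n, Generic z := by
  have key (u : Ω2 → ℝ) (hu : Measurable u) (h : ∀ x : ℝ, (μ : Measure Ω2).map u {x} = 0) :
      ∀ᵐ z ∂pmeas μ n, Function.Injective fun i => u (z i) := by
    have : ∀ᵐ z ∂pmeas μ n, ∀ i j : Fin n, i ≠ j → u (z i) ≠ u (z j) := by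
      refine ae_all_iff.2 fun i => ae_all_iff.2 fun j => ?_
      by_cases hij : i = j
      · simp [hij]
      · have h0 := measure_setOf_eq_zero hu h hij
        filter_upwards [compl_mem_ae_iff.2 h0] with z hz _ using hz
    filter_upwards [this] with z hz i j hij
    by_contra hne
    exact hz i j hne hij
  filter_upwards [key _ measurable_fst hμ.2.1, key _ measurable_snd hμ.2.2] with z h1 h2
  exact ⟨h1, h2⟩

lemma ae_mem_unitSq {μ : ProbabilityMeasure Ω2} (hμ : μ ∈ Pcal) :
    ∀ᵐ x ∂(μ : Measure Ω2), x ∈ unitSq :=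
  (mem_ae_iff_prob_eq_one (measurableSet_Icc.prod measurableSet_Icc)).2 hμ

/-- Exponential Chebyshev bound for linear functionals of the empirical measure. -/
lemma pmeas_integral_emp_ge_le (μ : Measure Ω2) [IsProbabilityMeasure μ] {f : Ω2 → ℝ}
    (hf : Measurable f) {b : ℝ} (hfb : ∫⁻ x, ENNReal.ofReal (Real.exp (f x)) ∂μ ≤
      ENNReal.ofReal (1 + b)) (hb : 0 ≤ 1 + b) (c : ℝ) {n : ℕ} (hn : 0 < n) :
    pmeas μ n {z | c ≤ ∫ x, f x ∂emp z - b} ≤ ENNReal.ofReal (Real.exp (-(n * c))) := by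
  have hn' : (0 : ℝ) < n := by exact_mod_cast hn
  have hfe : Measurable fun x => ENNReal.ofReal (Real.exp (f x)) := by fun_prop
  have hsub : {z : Fin n → Ω2 | c ≤ ∫ x, f x ∂emp z - b} ⊆
      {z | ENNReal.ofReal (Real.exp (n * (c + b))) ≤
        ∏ i, ENNReal.ofReal (Real.exp (f (z i)))} := by
    intro z hz
    simp only [Set.mem_ofPred_eq, integral_emp] at hz ⊢
    rw [← ENNReal.ofReal_prod_of_nonneg (fun _ _ => (Real.exp_pos _).le), ← Real.exp_sum]
    refine ENNReal.ofReal_le_ofReal (Real.exp_le_exp.2 ?_)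
    have : c + b ≤ (∑ i, f (z i)) / n := by linarith
    rw [le_div_iff₀ hn'] at this
    linarith
  have hM := mul_meas_ge_le_lintegral₀ (μ := pmeas μ n)
    (f := fun z : Fin n → Ω2 => ∏ i, ENNReal.ofReal (Real.exp (f (z i))))
    (Measurable.aemeasurable (by fun_prop)) (ENNReal.ofReal (Real.exp (n * (c + b))))
  rw [lintegral_prod_pmeas μ (f := fun _ x => ENNReal.ofReal (Real.exp (f x))) (fun _ => hfe)] at hM
  simp only [Finset.prod_const, Finset.card_univ, Fintype.card_fin] at hM
  have h3 : (∫⁻ x, ENNReal.ofReal (Real.exp (f x)) ∂μ) ^ n ≤ ENNReal.ofReal (Real.exp (n * b)) := by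
    calc _ ≤ (ENNReal.ofReal (1 + b)) ^ n := by gcongr
      _ = ENNReal.ofReal ((1 + b) ^ n) := (ENNReal.ofReal_pow hb n).symm
      _ ≤ _ := by
        refine ENNReal.ofReal_le_ofReal ?_
        rw [Real.exp_nat_mul]
        gcongr
        linarith [Real.add_one_le_exp b]
  have h4 := hM.trans h3
  refine (measure_mono hsub).trans ?_
  have hne : ENNReal.ofReal (Real.exp (n * (c + b))) ≠ 0 := by
    simpa using Real.exp_pos _
  rw [mul_comm, ← ENNReal.le_div_iff_mul_le (Or.inl hne) (Or.inl ENNReal.ofReal_ne_top)] at h4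
  refine h4.trans (le_of_eq ?_)
  rw [← ENNReal.ofReal_div_of_pos (Real.exp_pos _), ← Real.exp_sub]
  congr 2
  ring

lemma pmeas_withDensity (μ : Measure Ω2) [IsProbabilityMeasure μ] {d : Ω2 → ℝ≥0∞}
    (hd : Measurable d) (h1 : IsProbabilityMeasure (μ.withDensity d)) (n : ℕ) :
    pmeas (μ.withDensity d) n = (pmeas μ n).withDensity fun z => ∏ i, d (z i) := by
  refine Measure.pi_eq fun s hs => ?_
  rw [withDensity_apply _ (MeasurableSet.univ_pi hs),
    ← lintegral_indicator (MeasurableSet.univ_pi hs)]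
  have : ∀ z : Fin n → Ω2, (Set.pi Set.univ s).indicator (fun z => ∏ i, d (z i)) z =
      ∏ i, (s i).indicator d (z i) := by
    intro z
    by_cases hz : z ∈ Set.pi Set.univ s
    · rw [Set.indicator_of_mem hz]
      exact Finset.prod_congr rfl fun i _ => (Set.indicator_of_mem (hz i trivial) _).symm
    · rw [Set.indicator_of_notMem hz]
      simp only [Set.mem_pi, Set.mem_univ, true_implies, not_forall] at hz
      obtain ⟨i, hi⟩ := hz
      exact (Finset.prod_eq_zero (Finset.mem_univ i) (Set.indicator_of_notMem hi _)).symm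
  simp only [this]
  rw [lintegral_prod_pmeas μ (f := fun i => (s i).indicator d) fun i => hd.indicator (hs i)]
  refine Finset.prod_congr rfl fun i _ => ?_
  rw [withDensity_apply _ (hs i), lintegral_indicator (hs i)]

/-- The pattern density of an empirical measure has expectation at least the probability that a
uniformly chosen map is injective, times the pattern density of the sampling law. -/
lemma descFactorial_mul_tPat_le {k n : ℕ} (hn : 0 < n) (σ : Equiv.Perm (Fin k)) (ν : Measure Ω2)
    [IsProbabilityMeasure ν] :
    (n.descFactorial k : ℝ) / n ^ k * tPat σ ν ≤ ∫ z, tPat σ (emp z) ∂pmeas ν n := by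
  have hm (φ : Fin k → Fin n) : Measurable fun z : Fin n → Ω2 => z ∘ φ :=
    measurable_pi_lambda _ fun i => measurable_pi_apply _
  have hfint (φ : Fin k → Fin n) : Integrable (fun z => hPat σ (z ∘ φ)) (pmeas ν n) :=
    Integrable.of_bound ((measurable_hPat σ).comp (hm φ)).aestronglyMeasurable 1
      (Eventually.of_forall fun z => by
        rw [Real.norm_of_nonneg (hPat_nonneg σ _)]; exact hPat_le_one σ _)
  have hinj (φ : Fin k → Fin n) (hφ : Function.Injective φ) :
      ∫ z, hPat σ (z ∘ φ) ∂pmeas ν n = tPat σ ν := by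
    have h := Measure.map_infinitePi_infinitePi_of_inj (P := fun _ : Fin n => ν) hφ
    rw [Measure.infinitePi_eq_pi, Measure.infinitePi_eq_pi] at h
    rw [tPat, ← h]
    exact (integral_map (hm φ).aemeasurable (measurable_hPat σ).aestronglyMeasurable).symm
  simp only [tPat_emp hn]
  rw [integral_div, integral_finsetSum _ fun φ _ => hfint φ, div_mul_eq_mul_div]
  gcongr
  calc (n.descFactorial k : ℝ) * tPat σ ν
      = ∑ φ ∈ Finset.univ.filter (fun φ : Fin k → Fin n => Function.Injective φ),
          ∫ z, hPat σ (z ∘ φ) ∂pmeas ν n := by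
        rw [Finset.sum_congr rfl fun φ hφ => hinj φ (Finset.mem_filter.1 hφ).2, Finset.sum_const,
          nsmul_eq_mul]
        congr 2
        have := Fintype.card_embedding_eq (α := Fin k) (β := Fin n)
        rw [Fintype.card_fin, Fintype.card_fin] at this
        rw [← this, ← Fintype.card_subtype]
        exact Fintype.card_congr (Equiv.subtypeInjectiveEquivEmbedding _ _).symm
    _ ≤ _ := Finset.sum_le_sum_of_subset_of_nonneg (Finset.filter_subset _ _)
        fun φ _ _ => integral_nonneg fun z => hPat_nonneg σ _

lemma measurable_tPat_emp {k n : ℕ} (hn : 0 < n) (σ : Equiv.Perm (Fin k)) :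
    Measurable fun z : Fin n → Ω2 => tPat σ (emp z) := by
  simp only [tPat_emp hn]
  exact (Finset.measurable_sum _ fun φ _ => (measurable_hPat σ).comp
    (measurable_pi_lambda _ fun i => measurable_pi_apply _)).div_const _

/-! ### The lower bound by change of measure -/

lemma KL_eq_klDiv (ν μ : Measure Ω2) [IsFiniteMeasure ν] [IsFiniteMeasure μ] :
    KL ν μ = InformationTheory.klDiv ν μ := by
  classical
  rw [InformationTheory.klDiv_eq_lintegral_klFun, KL]
  rfl

/-- Weak law of large numbers (upper tail) on the finite product spaces. -/
lemma tendsto_pmeas_sum_gt {ν : Measure Ω2} [IsProbabilityMeasure ν] {f : Ω2 → ℝ}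
    (hf : Measurable f) (hfi : Integrable f ν) {c : ℝ} (hc : ∫ x, f x ∂ν < c) :
    Tendsto (fun n : ℕ => pmeas ν n {z | n * c < ∑ i, f (z i)}) atTop (𝓝 0) := by
  set P : Measure (ℕ → Ω2) := Measure.infinitePi fun _ : ℕ => ν with hP
  have hev (i : ℕ) : MeasurePreserving (fun ω : ℕ → Ω2 => ω i) P ν :=
    measurePreserving_eval_infinitePi (fun _ : ℕ => ν) i
  have hX (i : ℕ) : ProbabilityTheory.IdentDistrib (fun ω : ℕ → Ω2 => f (ω i))
      (fun ω => f (ω 0)) P P := by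
    refine ⟨(hf.comp (measurable_pi_apply i)).aemeasurable,
      (hf.comp (measurable_pi_apply 0)).aemeasurable, ?_⟩
    have h (i : ℕ) : P.map (fun ω => f (ω i)) = ν.map f := by
      rw [← (hev i).map_eq, Measure.map_map hf (measurable_pi_apply i)]; rfl
    rw [h, h]
  have hslln := ProbabilityTheory.strong_law_ae_real (μ := P) (fun i ω => f (ω i))
    ((hev 0).integrable_comp_of_integrable hfi)
    (fun i j hij => (ProbabilityTheory.iIndepFun_infinitePi (P := fun _ : ℕ => ν)
      (X := fun _ => f) (fun _ => hf)).indepFun hij) hX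
  have hfint : ∫ ω, f (ω 0) ∂P = ∫ x, f x ∂ν := by
    rw [← (hev 0).map_eq, integral_map (measurable_pi_apply 0).aemeasurable
      hf.aestronglyMeasurable]
  have hmeas (n : ℕ) : Measurable fun ω : ℕ → Ω2 => (∑ i ∈ Finset.range n, f (ω i)) / n :=
    (Finset.measurable_sum _ fun i _ => hf.comp (measurable_pi_apply i)).div_const _
  have hin := tendstoInMeasure_of_tendsto_ae (fun n => (hmeas n).aestronglyMeasurable) hslln
  rw [tendstoInMeasure_iff_norm] at hin
  have h0 := hin (c - ∫ x, f x ∂ν) (by linarith)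
  refine tendsto_of_tendsto_of_tendsto_of_le_of_le tendsto_const_nhds h0
    (fun _ => bot_le) fun n => ?_
  have hmap : P.map (fun ω (i : Fin n) => ω i) = pmeas ν n := by
    rw [pmeas, ← Measure.infinitePi_eq_pi]
    exact Measure.map_infinitePi_infinitePi_of_inj (P := fun _ : ℕ => ν) Fin.val_injective
  have hms : MeasurableSet {z : Fin n → Ω2 | n * c < ∑ i, f (z i)} :=
    measurableSet_lt measurable_const
      (Finset.measurable_sum _ fun i _ => hf.comp (measurable_pi_apply i))
  simp only
  rw [← hmap, Measure.map_apply (by fun_prop) hms]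
  refine measure_mono fun ω hω => ?_
  simp only [Set.mem_preimage, Set.mem_ofPred_eq] at hω ⊢
  rw [Fin.sum_univ_eq_sum_range (fun i => f (ω i)) n] at hω
  rw [hfint]
  have hn : (0 : ℝ) < n := by
    rcases Nat.eq_zero_or_pos n with rfl | h
    · simp at hω
    · exact_mod_cast h
  have : c < (∑ i ∈ Finset.range n, f (ω i)) / n := by
    rw [lt_div_iff₀ hn]; linarith
  rw [Real.norm_eq_abs]
  exact le_trans (by linarith) (le_abs_self _)

lemma tendsto_descFactorial_div_pow (k : ℕ) :
    Tendsto (fun n : ℕ => (n.descFactorial k : ℝ) / n ^ k) atTop (𝓝 1) := by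
  have h := isEquivalent_descFactorial k
  exact (Asymptotics.isEquivalent_iff_tendsto_one (by
    filter_upwards [eventually_gt_atTop 0] with n hn
    positivity)).1 h

/-- The tilting step: an event is at least `exp (-n c)` times as likely under `μ^{⊗n}` as its
intersection with `{(1/n) ∑ log (dν/dμ) ≤ c}` is under `ν^{⊗n}`. -/
lemma pmeas_tilt_le {μ ν : Measure Ω2} [IsProbabilityMeasure μ] [IsProbabilityMeasure ν]
    (hac : ν ≪ μ) (c : ℝ) {n : ℕ} {A : Set (Fin n → Ω2)} (hA : MeasurableSet A) :
    pmeas ν n (A ∩ {z | ∑ i, llr ν μ (z i) ≤ n * c}) ≤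
      ENNReal.ofReal (Real.exp (n * c)) * pmeas μ n A := by
  set d : Ω2 → ℝ≥0∞ := fun x => ENNReal.ofReal (ν.rnDeriv μ x).toReal with hd
  have hdm : Measurable d := by fun_prop
  have hν : μ.withDensity d = ν := by
    conv_rhs => rw [← Measure.withDensity_rnDeriv_eq ν μ hac]
    refine withDensity_congr_ae ?_
    filter_upwards [Measure.rnDeriv_lt_top ν μ] with x hx
    exact ENNReal.ofReal_toReal hx.ne
  have hS : MeasurableSet {z : Fin n → Ω2 | ∑ i, llr ν μ (z i) ≤ n * c} :=
    measurableSet_le (Finset.measurable_sum _ fun i _ =>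
      (measurable_llr ν μ).comp (measurable_pi_apply i)) measurable_const
  have hp := pmeas_withDensity μ hdm (by rw [hν]; infer_instance) n
  rw [hν] at hp
  rw [hp, withDensity_apply _ (hA.inter hS)]
  calc _ ≤ ∫⁻ _ in A ∩ {z | ∑ i, llr ν μ (z i) ≤ n * c},
        ENNReal.ofReal (Real.exp (n * c)) ∂pmeas μ n := by
        refine setLIntegral_mono measurable_const fun z hz => ?_
        simp only [hd]
        rw [← ENNReal.ofReal_prod_of_nonneg fun _ _ => ENNReal.toReal_nonneg]
        refine ENNReal.ofReal_le_ofReal ?_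
        by_cases h0 : ∃ i, (ν.rnDeriv μ (z i)).toReal = 0
        · obtain ⟨i, hi⟩ := h0
          rw [Finset.prod_eq_zero (Finset.mem_univ i) hi]
          exact (Real.exp_pos _).le
        · push Not at h0
          have : ∏ i, (ν.rnDeriv μ (z i)).toReal = Real.exp (∑ i, llr ν μ (z i)) := by
            rw [Real.exp_sum]
            refine Finset.prod_congr rfl fun i _ => ?_
            rw [llr, Real.exp_log (lt_of_le_of_ne ENNReal.toReal_nonneg (h0 i).symm)]
          rw [this]
          exact Real.exp_le_exp.2 hz.2
    _ ≤ _ := by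
        rw [setLIntegral_const]
        gcongr
        exact Set.inter_subset_left

lemma exists_pmeas_tPat_ge {k : ℕ} (σ : Equiv.Perm (Fin k)) {μ ν : Measure Ω2}
    [IsProbabilityMeasure μ] [IsProbabilityMeasure ν] {δ c : ℝ} (hδ0 : 0 ≤ δ)
    (hδ : δ < tPat σ ν) (hc : KL ν μ < ENNReal.ofReal c) :
    ∃ p > 0, ∀ᶠ n : ℕ in atTop, ENNReal.ofReal (p * Real.exp (-(n * c))) ≤
      pmeas μ n {z | δ ≤ tPat σ (emp z)} := by
  rw [KL_eq_klDiv] at hc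
  obtain ⟨hac, hfint⟩ := InformationTheory.klDiv_ne_top_iff.1 hc.ne_top
  have hkl := InformationTheory.toReal_klDiv_of_measure_eq hac (by simp)
  have hlt : ∫ x, llr ν μ x ∂ν < c := by
    rw [← hkl]
    exact (ENNReal.lt_ofReal_iff_toReal_lt hc.ne_top).1 hc
  set q := tPat σ ν - δ with hq
  have hq0 : 0 < q := by linarith
  refine ⟨q / 4, by linarith, ?_⟩
  have h1 := tendsto_pmeas_sum_gt (measurable_llr ν μ) hfint hlt
  have h1' : ∀ᶠ n : ℕ in atTop, pmeas ν n {z | n * c < ∑ i, llr ν μ (z i)} <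
      ENNReal.ofReal (q / 4) := h1.eventually (gt_mem_nhds (by simpa using hq0))
  have h2 : ∀ᶠ n : ℕ in atTop, δ + q / 2 < (n.descFactorial k : ℝ) / n ^ k * tPat σ ν := by
    have := (tendsto_descFactorial_div_pow k).mul_const (tPat σ ν)
    exact this.eventually (lt_mem_nhds (by rw [one_mul]; linarith))
  filter_upwards [h1', h2, eventually_gt_atTop 0] with n hn1 hn2 hn
  set A : Set (Fin n → Ω2) := {z | δ ≤ tPat σ (emp z)} with hA
  have hAm : MeasurableSet A := measurableSet_le measurable_const (measurable_tPat_emp hn σ)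
  have hAreal : q / 2 ≤ (pmeas ν n).real A := by
    have hle := descFactorial_mul_tPat_le hn σ ν
    have hmono : ∫ z, tPat σ (emp z) ∂pmeas ν n ≤
        ∫ z, (δ + A.indicator (fun _ => (1 : ℝ)) z) ∂pmeas ν n := by
      refine integral_mono_of_nonneg (Eventually.of_forall fun z => tPat_nonneg σ _)
        ((integrable_const _).add ((integrable_const _).indicator hAm))
        (Eventually.of_forall fun z => ?_)
      have := isProbabilityMeasure_emp hn z
      by_cases hz : z ∈ A
      · simp only [Set.indicator_of_mem hz]
        linarith [tPat_le_one σ (emp z)]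
      · simp only [Set.indicator_of_notMem hz, add_zero]
        exact (not_le.1 hz).le
    rw [integral_add (integrable_const _) ((integrable_const _).indicator hAm),
      integral_indicator_const _ hAm] at hmono
    simp at hmono
    linarith
  have hAE : ENNReal.ofReal (q / 2) ≤ pmeas ν n A := by
    rw [← ofReal_measureReal]
    exact ENNReal.ofReal_le_ofReal hAreal
  have hsplit : pmeas ν n A ≤ pmeas ν n (A ∩ {z | ∑ i, llr ν μ (z i) ≤ n * c}) +
      pmeas ν n {z | n * c < ∑ i, llr ν μ (z i)} := by
    refine (measure_mono fun z hz => ?_).trans (measure_union_le _ _)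
    rcases le_or_gt (∑ i, llr ν μ (z i)) (n * c) with h | h
    · exact Or.inl ⟨hz, h⟩
    · exact Or.inr h
  have h3 : ENNReal.ofReal (q / 4) ≤ ENNReal.ofReal (Real.exp (n * c)) * pmeas μ n A := by
    have h4 : ENNReal.ofReal (q / 4) + ENNReal.ofReal (q / 4) ≤
        ENNReal.ofReal (Real.exp (n * c)) * pmeas μ n A + ENNReal.ofReal (q / 4) := by
      rw [← ENNReal.ofReal_add (by linarith) (by linarith)]
      calc ENNReal.ofReal (q / 4 + q / 4) = ENNReal.ofReal (q / 2) := by congr 1; ring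
        _ ≤ _ := (hAE.trans hsplit).trans (add_le_add (pmeas_tilt_le hac c hAm) hn1.le)
    exact (ENNReal.add_le_add_iff_right ENNReal.ofReal_ne_top).1 h4
  rw [Real.exp_neg, ← div_eq_mul_inv, ENNReal.ofReal_div_of_pos (Real.exp_pos _)]
  exact ENNReal.div_le_of_le_mul' h3

/-! ### Variational lower bound for the Kullback–Leibler divergence -/

lemma abs_exp_sub_exp_le {a b M : ℝ} (ha : a ≤ M) (hb : b ≤ M) :
    |Real.exp a - Real.exp b| ≤ Real.exp M * |a - b| := by
  wlog h : b ≤ a generalizing a b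
  · rw [abs_sub_comm, abs_sub_comm a]
    exact this hb ha (le_of_not_ge h)
  have h1 : Real.exp b = Real.exp a * Real.exp (b - a) := by rw [← Real.exp_add]; ring_nf
  have h2 := Real.add_one_le_exp (b - a)
  have h3 : Real.exp a ≤ Real.exp M := Real.exp_le_exp.2 ha
  rw [abs_of_nonneg (sub_nonneg.2 (Real.exp_le_exp.2 h)), abs_of_nonneg (sub_nonneg.2 h)]
  have h4 : Real.exp a - Real.exp b ≤ Real.exp a * (a - b) := by
    rw [h1]; nlinarith [Real.exp_pos a]
  exact h4.trans (mul_le_mul_of_nonneg_right h3 (sub_nonneg.2 h))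

/-- Truncation of `g` to the interval `[1/(m+1), m+1]`. -/
def truncInv (m : ℕ) (g : ℝ) : ℝ := max ((m : ℝ) + 1)⁻¹ (min g (m + 1))

lemma measurable_truncInv (m : ℕ) : Measurable (truncInv m) := by
  unfold truncInv; fun_prop

lemma inv_le_truncInv (m : ℕ) (g : ℝ) : ((m : ℝ) + 1)⁻¹ ≤ truncInv m g := le_max_left _ _

lemma truncInv_pos (m : ℕ) (g : ℝ) : 0 < truncInv m g :=
  lt_of_lt_of_le (by positivity) (inv_le_truncInv m g)

lemma truncInv_le (m : ℕ) (g : ℝ) : truncInv m g ≤ m + 1 := by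
  refine max_le ?_ (min_le_right _ _)
  have h : (1 : ℝ) ≤ m + 1 := by linarith [(Nat.cast_nonneg m : (0 : ℝ) ≤ m)]
  exact (inv_le_one_of_one_le₀ h).trans h

lemma abs_log_truncInv_le (m : ℕ) (g : ℝ) : |Real.log (truncInv m g)| ≤ Real.log (m + 1) := by
  have hm : (0 : ℝ) < m + 1 := by positivity
  rw [abs_le, ← Real.log_inv]
  exact ⟨Real.log_le_log (by positivity) (inv_le_truncInv m g),
    Real.log_le_log (truncInv_pos m g) (truncInv_le m g)⟩

lemma mul_log_truncInv_nonneg (m : ℕ) (g : ℝ) :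
    0 ≤ g * Real.log (truncInv m g) + 1 - truncInv m g := by
  have hm : (1 : ℝ) ≤ m + 1 := by linarith [(Nat.cast_nonneg m : (0 : ℝ) ≤ m)]
  have hm' : ((m : ℝ) + 1)⁻¹ ≤ 1 := inv_le_one_of_one_le₀ hm
  have hpos := truncInv_pos m g
  have h1 : truncInv m g - 1 ≤ truncInv m g * Real.log (truncInv m g) := by
    have h := mul_le_mul_of_nonneg_left (Real.one_sub_inv_le_log_of_pos hpos) hpos.le
    rwa [mul_sub, mul_one, mul_inv_cancel₀ hpos.ne'] at h
  have h2 : truncInv m g * Real.log (truncInv m g) ≤ g * Real.log (truncInv m g) := by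
    rcases le_total g (m + 1) with h | h
    · rcases le_total ((m : ℝ) + 1)⁻¹ g with h' | h'
      · have : truncInv m g = g := by rw [truncInv, min_eq_left h, max_eq_right h']
        rw [this]
      · have : truncInv m g = ((m : ℝ) + 1)⁻¹ := by rw [truncInv, min_eq_left h, max_eq_left h']
        rw [this]
        exact mul_le_mul_of_nonpos_right h' (Real.log_nonpos (by positivity) hm')
    · have : truncInv m g = m + 1 := by
        rw [truncInv, min_eq_right h, max_eq_right (hm'.trans hm)]
      rw [this]
      exact mul_le_mul_of_nonneg_right h (Real.log_nonneg hm)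
  linarith

lemma tendsto_mul_log_truncInv {g : ℝ} (hg : 0 ≤ g) :
    Tendsto (fun m : ℕ => g * Real.log (truncInv m g) + 1 - truncInv m g) atTop
      (𝓝 (g * Real.log g + 1 - g)) := by
  have h0 : Tendsto (fun m : ℕ => ((m : ℝ) + 1)⁻¹) atTop (𝓝 0) := by
    simpa [one_div] using tendsto_one_div_add_atTop_nhds_zero_nat (𝕜 := ℝ)
  have h1 : Tendsto (fun m : ℕ => truncInv m g) atTop (𝓝 g) := by
    have h2 : Tendsto (fun m : ℕ => max ((m : ℝ) + 1)⁻¹ g) atTop (𝓝 g) := by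
      simpa [max_eq_right hg] using h0.max (tendsto_const_nhds (x := g))
    refine h2.congr' ?_
    filter_upwards [eventually_ge_atTop ⌈g⌉₊] with m hm
    have : g ≤ m + 1 := (Nat.le_ceil g).trans (by exact_mod_cast Nat.le_succ_of_le hm)
    rw [truncInv, min_eq_left this]
  rcases hg.eq_or_lt with rfl | hg
  · simpa using h1.const_sub 1
  · exact (((h1.log hg.ne').const_mul g).add_const 1).sub h1

lemma exists_measurable_lt_of_lt_KL {ν μ : Measure Ω2} [IsProbabilityMeasure ν]
    [IsProbabilityMeasure μ] {c : ℝ} (hc : ENNReal.ofReal c < KL ν μ) :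
    ∃ (f : Ω2 → ℝ) (M : ℝ), Measurable f ∧ (∀ x, |f x| ≤ M) ∧
      c < ∫ x, f x ∂ν - ∫ x, (Real.exp (f x) - 1) ∂μ := by
  by_cases hac : ν ≪ μ
  · rw [KL, if_pos hac] at hc
    set g : Ω2 → ℝ := fun z => (ν.rnDeriv μ z).toReal with hg
    have hgm : Measurable g := (Measure.measurable_rnDeriv ν μ).ennreal_toReal
    have hg0 : ∀ z, 0 ≤ g z := fun z => ENNReal.toReal_nonneg
    have hgi : Integrable g μ := Measure.integrable_toReal_rnDeriv
    have htm : ∀ m : ℕ, Measurable fun z => truncInv m (g z) :=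
      fun m => (measurable_truncInv m).comp hgm
    have hfat := lintegral_liminf_le (μ := μ) (u := (atTop : Filter ℕ))
      (f := fun m z => ENNReal.ofReal (g z * Real.log (truncInv m (g z)) + 1 - truncInv m (g z)))
      (fun m => (((hgm.mul (htm m).log).add_const 1).sub (htm m)).ennreal_ofReal)
    have hlim : ∀ z, liminf (fun m : ℕ => ENNReal.ofReal
        (g z * Real.log (truncInv m (g z)) + 1 - truncInv m (g z))) atTop =
        ENNReal.ofReal (g z * Real.log (g z) + 1 - g z) := fun z =>
      ((ENNReal.continuous_ofReal.tendsto _).comp (tendsto_mul_log_truncInv (hg0 z))).liminf_eq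
    simp only [hlim] at hfat
    obtain ⟨m, hm⟩ := (eventually_lt_of_lt_liminf (hc.trans_le hfat)).exists
    have hlog : Integrable (fun z => g z * Real.log (truncInv m (g z))) μ :=
      hgi.mul_bdd (htm m).log.aestronglyMeasurable
        (.of_forall fun z => abs_log_truncInv_le m (g z))
    have htr : Integrable (fun z => truncInv m (g z)) μ :=
      Integrable.of_bound (htm m).aestronglyMeasurable (m + 1 : ℝ) <| .of_forall fun z => by
        rw [Real.norm_of_nonneg (truncInv_pos m _).le]; exact truncInv_le m _
    refine ⟨fun z => Real.log (truncInv m (g z)), Real.log (m + 1), (htm m).log,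
      fun z => abs_log_truncInv_le m (g z), ?_⟩
    have hfint : Integrable (fun z => g z * Real.log (truncInv m (g z)) + 1 - truncInv m (g z)) μ :=
      (hlog.add (integrable_const 1)).sub htr
    rw [← ofReal_integral_eq_lintegral_ofReal hfint
      (.of_forall fun z => mul_log_truncInv_nonneg m (g z))] at hm
    have hm' := (ENNReal.ofReal_lt_ofReal_iff'.1 hm).1
    have e1 : ∫ z, Real.log (truncInv m (g z)) ∂ν = ∫ z, g z * Real.log (truncInv m (g z)) ∂μ :=
      (integral_rnDeriv_smul hac).symm
    have e2 : ∫ z, (g z * Real.log (truncInv m (g z)) + 1 - truncInv m (g z)) ∂μ =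
        ∫ z, g z * Real.log (truncInv m (g z)) ∂μ - ∫ z, (truncInv m (g z) - 1) ∂μ := by
      have htr1 : Integrable (fun z => truncInv m (g z) - 1) μ := htr.sub (integrable_const 1)
      rw [← integral_sub hlog htr1]
      exact integral_congr_ae (.of_forall fun z => by ring)
    simp only [Real.exp_log (truncInv_pos m _)]
    rw [e1, ← e2]
    exact hm'
  · obtain ⟨s, hs⟩ : ∃ s, ¬ (μ s = 0 → ν s = 0) := by
      by_contra h
      push Not at h
      exact hac fun s hs => h s hs
    obtain ⟨hs0, hs1⟩ := Classical.not_imp.1 hs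
    obtain ⟨t, hst, htm, ht0⟩ := exists_measurable_superset_of_null hs0
    have ht1 : 0 < ν.real t :=
      ENNReal.toReal_pos (fun h => hs1 (measure_mono_null hst h)) (measure_ne_top _ _)
    set M : ℝ := (|c| + 1) / ν.real t with hM
    have hM0 : 0 ≤ M := by positivity
    refine ⟨t.indicator fun _ => M, M, measurable_const.indicator htm, fun x => ?_, ?_⟩
    · by_cases hx : x ∈ t <;> simp [hx, abs_of_nonneg hM0, hM0]
    · have h1 : ∫ x, (Real.exp (t.indicator (fun _ => M) x) - 1) ∂μ = 0 := by
        rw [← integral_zero Ω2 ℝ (μ := μ)]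
        refine integral_congr_ae ?_
        filter_upwards [measure_eq_zero_iff_ae_notMem.1 ht0] with x hx
        simp [hx]
      rw [h1, integral_indicator_const _ htm, smul_eq_mul, hM, mul_div_cancel₀ _ ht1.ne']
      linarith [le_abs_self c]

lemma exists_boundedContinuous_lt_of_lt_KL {ν μ : Measure Ω2} [IsProbabilityMeasure ν]
    [IsProbabilityMeasure μ] {c : ℝ} (hc : ENNReal.ofReal c < KL ν μ) :
    ∃ f : BoundedContinuousFunction Ω2 ℝ, c < ∫ x, f x ∂ν - ∫ x, (Real.exp (f x) - 1) ∂μ := by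
  obtain ⟨f, M, hfm, hfM, hf⟩ := exists_measurable_lt_of_lt_KL hc
  set d := ∫ x, f x ∂ν - ∫ x, (Real.exp (f x) - 1) ∂μ - c with hd
  have hd0 : 0 < d := by rw [hd]; linarith
  have hfi : ∀ (ρ : Measure Ω2) [IsFiniteMeasure ρ], Integrable f ρ := fun ρ _ =>
    Integrable.of_bound hfm.aestronglyMeasurable M (.of_forall hfM)
  set K := 1 + Real.exp M with hK
  have hK0 : 0 < K := by positivity
  obtain ⟨g, hg, -⟩ := (hfi (ν + μ)).exists_boundedContinuous_integral_sub_le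
    (ε := d / (2 * K)) (by positivity)
  have hM0 : 0 ≤ M := (abs_nonneg _).trans (hfM 0)
  have hcl : ∀ x, |max (-M) (min (g x) M)| ≤ M := fun x =>
    abs_le.2 ⟨le_max_left _ _, max_le (by linarith) (min_le_right _ _)⟩
  set h : BoundedContinuousFunction Ω2 ℝ := BoundedContinuousFunction.ofNormedAddCommGroup
    (fun x => max (-M) (min (g x) M)) (by fun_prop) M hcl with hh
  have hhM : ∀ x, |h x| ≤ M := hcl
  have hhi : ∀ (ρ : Measure Ω2) [IsFiniteMeasure ρ], Integrable h ρ := fun ρ _ => h.integrable ρ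
  have hfh : ∀ x, |f x - h x| ≤ |f x - g x| := fun x => by
    have e : f x = max (-M) (min (f x) M) := by
      rw [min_eq_left (abs_le.1 (hfM x)).2, max_eq_right (abs_le.1 (hfM x)).1]
    change |f x - max (-M) (min (g x) M)| ≤ _
    conv_lhs => rw [e]
    refine (abs_max_sub_max_le_max _ _ _ _).trans ?_
    rw [sub_self, abs_zero, max_eq_right (abs_nonneg _)]
    refine (abs_min_sub_min_le_max _ _ _ _).trans ?_
    rw [sub_self, abs_zero, max_eq_left (abs_nonneg _)]
  have hdi : ∀ (ρ : Measure Ω2) [IsFiniteMeasure ρ], Integrable (fun x => |f x - h x|) ρ :=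
    fun ρ _ => ((hfi ρ).sub (hhi ρ)).abs
  have hsum : ∫ x, |f x - h x| ∂ν + ∫ x, |f x - h x| ∂μ ≤ d / (2 * K) := by
    rw [← integral_add_measure (hdi ν) (hdi μ)]
    exact (integral_mono (hdi _) ((hfi _).sub (g.integrable _)).norm hfh).trans hg
  have hexp : ∀ (u : Ω2 → ℝ), Measurable u → (∀ x, |u x| ≤ M) →
      Integrable (fun x => Real.exp (u x) - 1) μ := fun u hu huM => by
    refine Integrable.sub (Integrable.of_bound hu.exp.aestronglyMeasurable (Real.exp M)
      (.of_forall fun x => ?_)) (integrable_const 1)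
    rw [Real.norm_of_nonneg (Real.exp_pos _).le]
    exact Real.exp_le_exp.2 (abs_le.1 (huM x)).2
  have h1 : ∫ x, f x ∂ν - ∫ x, h x ∂ν ≤ ∫ x, |f x - h x| ∂ν := by
    rw [← integral_sub (hfi ν) (hhi ν)]
    exact integral_mono ((hfi ν).sub (hhi ν)) (hdi ν) fun x => le_abs_self _
  have h2 : ∫ x, (Real.exp (h x) - 1) ∂μ - ∫ x, (Real.exp (f x) - 1) ∂μ ≤
      Real.exp M * ∫ x, |f x - h x| ∂μ := by
    rw [← integral_sub (hexp h h.continuous.measurable hhM) (hexp f hfm hfM),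
      ← integral_const_mul]
    refine integral_mono ((hexp h h.continuous.measurable hhM).sub (hexp f hfm hfM))
      ((hdi μ).const_mul _) fun x => ?_
    have := abs_exp_sub_exp_le (abs_le.1 (hhM x)).2 (abs_le.1 (hfM x)).2
    rw [abs_sub_comm (h x)] at this
    exact le_trans (by ring_nf; exact le_rfl) ((le_abs_self _).trans this)
  refine ⟨h, ?_⟩
  have hn1 : 0 ≤ ∫ x, |f x - h x| ∂ν := integral_nonneg fun x => abs_nonneg _
  have hn2 : 0 ≤ ∫ x, |f x - h x| ∂μ := integral_nonneg fun x => abs_nonneg _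
  have h3 : ∫ x, |f x - h x| ∂ν + Real.exp M * ∫ x, |f x - h x| ∂μ ≤ d / 2 := by
    have h4 : K * (∫ x, |f x - h x| ∂ν + ∫ x, |f x - h x| ∂μ) ≤ K * (d / (2 * K)) :=
      mul_le_mul_of_nonneg_left hsum hK0.le
    have h5 : K * (d / (2 * K)) = d / 2 := by field_simp
    rw [h5, hK] at h4
    nlinarith [mul_nonneg (Real.exp_pos M).le hn1]
  linarith

/-- A measure `ν` with large divergence from `μ` has a neighbourhood which the empirical measures
of i.i.d. samples from `μ` visit only with exponentially small probability. -/
lemma exists_mem_nhds_pmeas_emp_le {μ : Measure Ω2} [IsProbabilityMeasure μ]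
    {ν : ProbabilityMeasure Ω2} {c : ℝ} (hc : ENNReal.ofReal c < KL ν μ) :
    ∃ U ∈ 𝓝 ν, ∀ n : ℕ, 0 < n →
      pmeas μ n {z | ∃ ν' ∈ U, (ν' : Measure Ω2) = emp z} ≤
        ENNReal.ofReal (Real.exp (-(n * c))) := by
  obtain ⟨f, hf⟩ := exists_boundedContinuous_lt_of_lt_KL hc
  set b := ∫ x, (Real.exp (f x) - 1) ∂μ with hb
  have hfe : Integrable (fun x => Real.exp (f x)) μ := by
    refine Integrable.of_bound (f.continuous.measurable.exp.aestronglyMeasurable)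
      (Real.exp ‖f‖) (.of_forall fun x => ?_)
    rw [Real.norm_of_nonneg (Real.exp_pos _).le]
    exact Real.exp_le_exp.2 ((le_abs_self _).trans (f.norm_coe_le_norm x))
  have hbe : ∫ x, Real.exp (f x) ∂μ = 1 + b := by
    rw [hb, integral_sub hfe (integrable_const 1)]; simp
  have hb0 : 0 ≤ 1 + b := by rw [← hbe]; exact integral_nonneg fun x => (Real.exp_pos _).le
  have hfb : ∫⁻ x, ENNReal.ofReal (Real.exp (f x)) ∂μ ≤ ENNReal.ofReal (1 + b) := by
    rw [← hbe, ofReal_integral_eq_lintegral_ofReal hfe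
      (.of_forall fun x => (Real.exp_pos _).le)]
  refine ⟨{ν' | c < ∫ x, f x ∂(ν' : Measure Ω2) - b}, ?_, fun n hn => ?_⟩
  · refine IsOpen.mem_nhds (isOpen_lt continuous_const ?_) hf
    exact (ProbabilityMeasure.continuous_integral_boundedContinuousFunction f).sub
      continuous_const
  · refine (measure_mono ?_).trans
      (pmeas_integral_emp_ge_le μ f.continuous.measurable hfb hb0 c hn)
    rintro z ⟨ν', hν', h⟩
    have h' : c < ∫ x, f x ∂(ν' : Measure Ω2) - b := hν'
    rw [h] at h'
    exact h'.le

/-! ### Upper semicontinuity of pattern densities at measures with atomless marginals -/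

/-- The closed set of point configurations weakly inducing the pattern `σ`. -/
def weakPat {k : ℕ} (σ : Equiv.Perm (Fin k)) : Set (Fin k → Ω2) :=
  {z | ∃ τ : Equiv.Perm (Fin k),
    Monotone (fun i => (z (τ i)).1) ∧ Monotone (fun i => (z (τ (σ⁻¹ i))).2)}

lemma isClosed_weakPat {k : ℕ} (σ : Equiv.Perm (Fin k)) : IsClosed (weakPat σ) := by
  have : weakPat σ = ⋃ τ : Equiv.Perm (Fin k), ⋂ (i : Fin k) (j : Fin k) (_ : i ≤ j),
      {z : Fin k → Ω2 | (z (τ i)).1 ≤ (z (τ j)).1} ∩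
        {z | (z (τ (σ⁻¹ i))).2 ≤ (z (τ (σ⁻¹ j))).2} := by
    ext z
    simp only [weakPat, Monotone, Set.mem_ofPred_eq, Set.mem_iUnion, Set.mem_iInter,
      Set.mem_inter_iff]
    exact exists_congr fun τ => ⟨fun h i j hij => ⟨h.1 hij, h.2 hij⟩,
      fun h => ⟨fun i j hij => (h i j hij).1, fun i j hij => (h i j hij).2⟩⟩
  rw [this]
  refine isClosed_iUnion_of_finite fun τ => isClosed_iInter fun i => isClosed_iInter fun j =>
    isClosed_iInter fun _ => IsClosed.inter ?_ ?_
  · exact isClosed_le (by fun_prop) (by fun_prop)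
  · exact isClosed_le (by fun_prop) (by fun_prop)

lemma hPat_le_indicator {k : ℕ} (σ : Equiv.Perm (Fin k)) (z : Fin k → Ω2) :
    hPat σ z ≤ (weakPat σ).indicator (fun _ => 1) z := by
  by_cases hz : z ∈ weakPat σ
  · simpa [hz] using hPat_le_one σ z
  · rw [Set.indicator_of_notMem hz, hPat, if_neg]
    rintro ⟨τ, h1, h2⟩
    exact hz ⟨τ, h1.monotone, h2.monotone⟩

lemma Generic.indicator_eq_hPat {k : ℕ} (σ : Equiv.Perm (Fin k)) {z : Fin k → Ω2}
    (hz : Generic z) : (weakPat σ).indicator (fun _ => (1 : ℝ)) z = hPat σ z := by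
  refine le_antisymm ?_ (hPat_le_indicator σ z)
  by_cases hw : z ∈ weakPat σ
  · obtain ⟨τ, h1, h2⟩ := hw
    have h3 : hPat σ z = 1 := if_pos ⟨τ, h1.strictMono_of_injective
      (hz.1.comp τ.injective), h2.strictMono_of_injective
      (hz.2.comp (τ.injective.comp (σ⁻¹ : Equiv.Perm (Fin k)).injective))⟩
    rw [h3]
    exact Set.indicator_le_self' (fun _ _ => zero_le_one) z
  · rw [Set.indicator_of_notMem hw]
    exact hPat_nonneg σ z

lemma tPat_le_measureReal_weakPat {k : ℕ} (σ : Equiv.Perm (Fin k)) (ν : Measure Ω2)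
    [IsProbabilityMeasure ν] : tPat σ ν ≤ (pmeas ν k).real (weakPat σ) := by
  have hm := (isClosed_weakPat σ).measurableSet
  have h := integral_mono (integrable_hPat σ (pmeas ν k))
    ((integrable_const (1 : ℝ)).indicator hm) (hPat_le_indicator σ)
  simpa [tPat, pmeas, integral_indicator_const _ hm] using h

lemma measureReal_weakPat {k : ℕ} (σ : Equiv.Perm (Fin k)) {ν : ProbabilityMeasure Ω2}
    (hν : ν ∈ Mcal) : (pmeas ν k).real (weakPat σ) = tPat σ (ν : Measure Ω2) := by
  have hm := (isClosed_weakPat σ).measurableSet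
  have h : ∫ z, (weakPat σ).indicator (fun _ => (1 : ℝ)) z ∂pmeas ν k =
      ∫ z, hPat σ z ∂pmeas ν k := by
    refine integral_congr_ae ?_
    filter_upwards [ae_generic hν k] with z hz using hz.indicator_eq_hPat σ
  rw [integral_indicator_const _ hm, smul_eq_mul, mul_one] at h
  exact h

lemma eventually_tPat_lt {k : ℕ} (σ : Equiv.Perm (Fin k)) {ν : ProbabilityMeasure Ω2}
    (hν : ν ∈ Mcal) {δ : ℝ} (hδ : tPat σ (ν : Measure Ω2) < δ) :
    ∀ᶠ ν' : ProbabilityMeasure Ω2 in 𝓝 ν, tPat σ (ν' : Measure Ω2) < δ := by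
  have hpi : Continuous fun ν' : ProbabilityMeasure Ω2 =>
      ProbabilityMeasure.pi fun _ : Fin k => ν' :=
    ProbabilityMeasure.continuous_pi.comp (continuous_pi fun _ => continuous_id)
  have hls := ProbabilityMeasure.limsup_measure_closed_le_of_tendsto (hpi.tendsto ν)
    (isClosed_weakPat σ)
  have hlt : (pmeas ν k) (weakPat σ) < ENNReal.ofReal δ := by
    rw [ENNReal.lt_ofReal_iff_toReal_lt (measure_ne_top _ _)]
    exact (measureReal_weakPat σ hν).trans_lt hδ
  filter_upwards [eventually_lt_of_limsup_lt (hls.trans_lt hlt)] with ν' h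
  have hlt : (pmeas ν' k) (weakPat σ) < ENNReal.ofReal δ := h
  rw [ENNReal.lt_ofReal_iff_toReal_lt (measure_ne_top _ _)] at hlt
  exact (tPat_le_measureReal_weakPat σ _).trans_lt hlt

/-! ### Continuity of `Omap` at measures with atomless marginals -/

lemma continuous_cdf_of_forall_singleton_eq_zero {ρ : Measure ℝ} [IsProbabilityMeasure ρ]
    (h : ∀ x, ρ {x} = 0) : Continuous (ProbabilityTheory.cdf ρ) := by
  refine continuous_iff_continuousAt.2 fun x => ?_
  rw [(ProbabilityTheory.monotone_cdf ρ).continuousAt_iff_leftLim_eq_rightLim,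
    StieltjesFunction.rightLim_eq]
  have h1 := (ProbabilityTheory.cdf ρ).measure_singleton x
  rw [ProbabilityTheory.measure_cdf, h x, eq_comm, ENNReal.ofReal_eq_zero] at h1
  exact le_antisymm ((ProbabilityTheory.monotone_cdf ρ).leftLim_le le_rfl) (by linarith)

/-- Weak convergence to an atomless measure on the line implies uniform convergence of the
distribution functions. -/
lemma eventually_forall_abs_cdf_sub_le {ρ : ProbabilityMeasure ℝ}
    (h : ∀ x, (ρ : Measure ℝ) {x} = 0) {ε : ℝ} (hε : 0 < ε) :
    ∀ᶠ ρ' : ProbabilityMeasure ℝ in 𝓝 ρ, ∀ x,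
      |ProbabilityTheory.cdf (ρ' : Measure ℝ) x - ProbabilityTheory.cdf (ρ : Measure ℝ) x| ≤ ε := by
  have hcont := continuous_cdf_of_forall_singleton_eq_zero h
  have hpt (x : ℝ) : Tendsto (fun ρ' : ProbabilityMeasure ℝ =>
      ProbabilityTheory.cdf (ρ' : Measure ℝ) x) (𝓝 ρ)
      (𝓝 (ProbabilityTheory.cdf (ρ : Measure ℝ) x)) := by
    have hfr : ρ (frontier (Set.Iic x)) = 0 := by
      rw [frontier_Iic]
      exact (ProbabilityMeasure.null_iff_toMeasure_null _ _).2 (h x)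
    have := ProbabilityMeasure.tendsto_measure_of_null_frontier_of_tendsto
      (tendsto_id (α := ProbabilityMeasure ℝ) (x := 𝓝 ρ)) hfr
    simp only [ProbabilityTheory.cdf_eq_real]
    exact (NNReal.continuous_coe.tendsto _).comp this
  obtain ⟨m, hm⟩ := exists_nat_gt (3 / ε)
  have hm0 : (0 : ℝ) < m := lt_trans (by positivity) hm
  have hmε : 3 / (m : ℝ) < ε := by
    rw [div_lt_iff₀ hε] at hm
    rw [div_lt_iff₀ hm0]; linarith
  have hgrid (j : ℕ) (hj0 : 0 < j) (hjm : j < m) :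
      ∃ t, ProbabilityTheory.cdf (ρ : Measure ℝ) t = j / m := by
    have h0 : (0 : ℝ) < j / m := div_pos (by exact_mod_cast hj0) hm0
    have h1 : (j : ℝ) / m < 1 := (div_lt_one hm0).2 (by exact_mod_cast hjm)
    refine mem_range_of_exists_le_of_exists_ge hcont ?_ ?_
    · exact ((ProbabilityTheory.tendsto_cdf_atBot (ρ : Measure ℝ)).eventually
        (eventually_le_nhds h0)).exists
    · exact ((ProbabilityTheory.tendsto_cdf_atTop (ρ : Measure ℝ)).eventually
        (eventually_ge_nhds h1)).exists
  choose! t ht using hgrid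
  have hev : ∀ᶠ ρ' : ProbabilityMeasure ℝ in 𝓝 ρ, ∀ j ∈ Finset.range m,
      |ProbabilityTheory.cdf (ρ' : Measure ℝ) (t j) -
        ProbabilityTheory.cdf (ρ : Measure ℝ) (t j)| < 1 / m := by
    refine (Finset.eventually_all _).2 fun j _ => ?_
    exact (Metric.tendsto_nhds.1 (hpt (t j)) (1 / m) (by positivity))
  filter_upwards [hev] with ρ' hρ' x
  set v := ProbabilityTheory.cdf (ρ : Measure ℝ) x with hv
  have hv0 : 0 ≤ v := ProbabilityTheory.cdf_nonneg _ _
  have hv1 : v ≤ 1 := ProbabilityTheory.cdf_le_one _ _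
  have hw0 := ProbabilityTheory.cdf_nonneg (ρ' : Measure ℝ) x
  have hw1 := ProbabilityTheory.cdf_le_one (ρ' : Measure ℝ) x
  set w := ProbabilityTheory.cdf (ρ' : Measure ℝ) x with hw
  set i := ⌊v * m⌋₊ with hi
  have hi1 : (i : ℝ) ≤ v * m := Nat.floor_le (by positivity)
  have hi2 : v * m < i + 1 := Nat.lt_floor_add_one _
  have hwm : w * m - v * m ≤ 3 ∧ v * m - w * m ≤ 3 := by
    constructor
    · by_cases hc : i + 1 < m
      · have e := ht (i + 1) (by omega) hc
        have hlt : x < t (i + 1) := by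
          by_contra! hle
          have := ProbabilityTheory.monotone_cdf (ρ : Measure ℝ) hle
          rw [e, ← hv, div_le_iff₀ hm0] at this
          push_cast at this
          linarith
        have h2 := ProbabilityTheory.monotone_cdf (ρ' : Measure ℝ) hlt.le
        have h3 := (abs_lt.1 (hρ' (i + 1) (Finset.mem_range.2 hc))).2
        rw [e] at h3
        have h4 : w < ((i + 1 : ℕ) : ℝ) / m + 1 / m := by linarith
        rw [← add_div, lt_div_iff₀ hm0] at h4
        push_cast at h4
        linarith
      · have : (m : ℝ) ≤ i + 1 := by exact_mod_cast not_lt.1 hc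
        nlinarith
    · by_cases hc : 2 ≤ i
      · have him : i - 1 < m := by
          have : (i : ℝ) ≤ m := hi1.trans (by nlinarith)
          have : i ≤ m := by exact_mod_cast this
          omega
        have e := ht (i - 1) (by omega) him
        have hcast : ((i - 1 : ℕ) : ℝ) = i - 1 := by
          rw [Nat.cast_sub (by omega)]; simp
        have hlt : t (i - 1) ≤ x := by
          by_contra! hle
          have := ProbabilityTheory.monotone_cdf (ρ : Measure ℝ) hle.le
          rw [e, ← hv, le_div_iff₀ hm0, hcast] at this
          linarith
        have h2 := ProbabilityTheory.monotone_cdf (ρ' : Measure ℝ) hlt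
        have h3 := (abs_lt.1 (hρ' (i - 1) (Finset.mem_range.2 him))).1
        rw [e] at h3
        have h4 : ((i - 1 : ℕ) : ℝ) / m - 1 / m < w := by linarith
        rw [← sub_div, div_lt_iff₀ hm0, hcast] at h4
        linarith
      · have : (i : ℝ) ≤ 1 := by exact_mod_cast Nat.le_of_lt_succ (not_le.1 hc)
        nlinarith
  have hb (a b : ℝ) (hab : a * m - b * m ≤ 3) : a - b ≤ ε := by
    refine le_trans ?_ hmε.le
    rw [le_div_iff₀ hm0]; linarith
  exact abs_le.2 ⟨by linarith [hb v w hwm.2], hb w v hwm.1⟩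

lemma cdf_map_eq (ν : Measure Ω2) [IsProbabilityMeasure ν] {u : Ω2 → ℝ} (hu : Measurable u)
    (x : ℝ) : ProbabilityTheory.cdf (ν.map u) x = (ν {p | u p ≤ x}).toReal := by
  have := Measure.isProbabilityMeasure_map (μ := ν) hu.aemeasurable
  rw [ProbabilityTheory.cdf_eq_real, Measure.real, Measure.map_apply hu measurableSet_Iic]
  rfl

lemma levyProkhorovEDist_map_le {ν : Measure Ω2} [IsProbabilityMeasure ν] {T T' : Ω2 → Ω2}
    (hT : Measurable T) (hT' : Measurable T') {ε : ℝ} (hε : 0 ≤ ε)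
    (h : ∀ p, dist (T p) (T' p) ≤ ε) :
    levyProkhorovEDist (ν.map T) (ν.map T') ≤ ENNReal.ofReal ε := by
  have := Measure.isProbabilityMeasure_map (μ := ν) hT.aemeasurable
  have := Measure.isProbabilityMeasure_map (μ := ν) hT'.aemeasurable
  refine levyProkhorovEDist_le_of_forall_le _ _ _ fun ε' B h1 h2 hB => ?_
  rw [Measure.map_apply hT hB, Measure.map_apply hT' Metric.isOpen_thickening.measurableSet]
  refine (measure_mono fun p hp => ?_).trans le_self_add
  refine Metric.mem_thickening_iff.2 ⟨T p, hp, ?_⟩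
  rw [dist_comm]
  exact (h p).trans_lt ((ENNReal.ofReal_lt_iff_lt_toReal hε h2.ne).1 h1)

lemma eventually_levyProkhorovEDist_lt {ν : ProbabilityMeasure Ω2} {ε : ℝ≥0∞} (hε : 0 < ε) :
    ∀ᶠ ν' : ProbabilityMeasure Ω2 in 𝓝 ν,
      levyProkhorovEDist (ν' : Measure Ω2) (ν : Measure Ω2) < ε :=
  (LevyProkhorov.continuous_ofMeasure_probabilityMeasure.tendsto ν).eventually
    (Metric.eball_mem_nhds _ hε)

lemma eventually_dLPE_Omap_lt {ν : ProbabilityMeasure Ω2} (hν : ν ∈ Mcal) {ε : ℝ} (hε : 0 < ε) :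
    ∀ᶠ ν' : ProbabilityMeasure Ω2 in 𝓝 ν,
      dLPE (Omap (ν' : Measure Ω2)) (Omap (ν : Measure Ω2)) < ENNReal.ofReal ε := by
  have hcdf (u : Ω2 → ℝ) (hu : Continuous u) (h0 : ∀ x, (ν : Measure Ω2).map u {x} = 0) :
      Continuous (fun x => ((ν : Measure Ω2) {p | u p ≤ x}).toReal) ∧
      ∀ᶠ ν' : ProbabilityMeasure Ω2 in 𝓝 ν, ∀ x, |((ν' : Measure Ω2) {p | u p ≤ x}).toReal -
        ((ν : Measure Ω2) {p | u p ≤ x}).toReal| ≤ ε / 2 := by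
    simp only [← cdf_map_eq _ hu.measurable]
    have := Measure.isProbabilityMeasure_map (μ := (ν : Measure Ω2)) hu.measurable.aemeasurable
    refine ⟨continuous_cdf_of_forall_singleton_eq_zero h0, ?_⟩
    exact ((ProbabilityMeasure.continuous_map hu).tendsto ν).eventually
      (eventually_forall_abs_cdf_sub_le (ρ := ν.map hu.measurable.aemeasurable) h0 (half_pos hε))
  obtain ⟨hcX, hX⟩ := hcdf Prod.fst continuous_fst hν.2.1
  obtain ⟨hcY, hY⟩ := hcdf Prod.snd continuous_snd hν.2.2
  have hT : Continuous fun p : Ω2 => (cdfX ν p.1, cdfY ν p.2) :=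
    (hcX.comp continuous_fst).prodMk (hcY.comp continuous_snd)
  have hmap := ((ProbabilityMeasure.continuous_map hT).tendsto ν).eventually
    (eventually_levyProkhorovEDist_lt (ENNReal.ofReal_pos.2 (half_pos hε)))
  filter_upwards [hX, hY, hmap] with ν' h1 h2 h3
  calc dLPE (Omap (ν' : Measure Ω2)) (Omap (ν : Measure Ω2))
      ≤ levyProkhorovEDist (Omap (ν' : Measure Ω2))
          ((ν' : Measure Ω2).map fun p => (cdfX ν p.1, cdfY ν p.2)) +
        levyProkhorovEDist ((ν' : Measure Ω2).map fun p => (cdfX ν p.1, cdfY ν p.2))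
          (Omap (ν : Measure Ω2)) := levyProkhorovEDist_triangle _ _ _
    _ < ENNReal.ofReal (ε / 2) + ENNReal.ofReal (ε / 2) := by
        refine ENNReal.add_lt_add_of_le_of_lt ?_ ?_ h3
        · exact ((levyProkhorovEDist_map_le (measurable_cdfXY _) hT.measurable (half_pos hε).le
            fun p => max_le (h1 p.1) (h2 p.2)).trans_lt ENNReal.ofReal_lt_top).ne
        · exact levyProkhorovEDist_map_le (measurable_cdfXY _) hT.measurable (half_pos hε).le
            fun p => max_le (h1 p.1) (h2 p.2)
    _ = ENNReal.ofReal ε := by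
        rw [← ENNReal.ofReal_add (half_pos hε).le (half_pos hε).le, add_halves]

/-! ### Compactness and the exponential upper bound -/

lemma isCompact_Pcal : IsCompact Pcal := by
  have hm : MeasurableSet unitSq := measurableSet_Icc.prod measurableSet_Icc
  have h := isCompact_setOfPred_probabilityMeasure_mass_eq_compl_isCompact_le (E := Ω2)
    (u := fun _ => 0) (K := fun _ => unitSq) tendsto_const_nhds
    (fun _ => isCompact_Icc.prod isCompact_Icc) (Or.inr monotone_const)
  convert h using 1
  ext ν
  rw [Pcal, Set.mem_ofPred_eq, Set.mem_ofPred_eq, ← prob_compl_eq_zero_iff hm]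
  simp [ProbabilityMeasure.null_iff_toMeasure_null]

lemma emp_unitSq {n : ℕ} (hn : 0 < n) {z : Fin n → Ω2} (hz : ∀ i, z i ∈ unitSq) :
    emp z unitSq = 1 := by
  have : (n : ℝ≥0∞) ≠ 0 := by exact_mod_cast hn.ne'
  have hm : MeasurableSet unitSq := measurableSet_Icc.prod measurableSet_Icc
  rw [emp, Measure.smul_apply, Measure.finsetSum_apply]
  simp [Measure.dirac_apply' _ hm, hz, ENNReal.inv_mul_cancel this]

lemma mem_Mcal_of_absolutelyContinuous {μ ν : ProbabilityMeasure Ω2} (hμ : μ ∈ Mcal)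
    (hν : ν ∈ Pcal) (h : (ν : Measure Ω2) ≪ μ) : ν ∈ Mcal :=
  ⟨hν, fun x => h.map measurable_fst (hμ.2.1 x), fun y => h.map measurable_snd (hμ.2.2 y)⟩

/-- The samples whose pattern density is at least `δ` while the empirical measure of the induced
permutation is `ε`-far from the minimizers. -/
def farSet {k : ℕ} (σ : Equiv.Perm (Fin k)) (μ : Measure Ω2) (δ ε : ℝ) (n : ℕ) :
    Set (Fin n → Ω2) :=
  {z | ENNReal.ofReal ε ≤ (⨅ ν ∈ Gset σ μ δ, dLPE (EmM (inducedPerm z)) (Omap ↑ν)) ∧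
    δ ≤ tPerm σ (inducedPerm z)}

/-- The part of `farSet` consisting of generic samples whose empirical measure lies in `S`. -/
def farSetIn {k : ℕ} (σ : Equiv.Perm (Fin k)) (μ : Measure Ω2) (δ ε : ℝ)
    (S : Set (ProbabilityMeasure Ω2)) (n : ℕ) : Set (Fin n → Ω2) :=
  {z | z ∈ farSet σ μ δ ε n ∧ Generic z ∧ ∃ ν ∈ S, (ν : Measure Ω2) = emp z}

lemma exists_mem_nhds_farSetIn_le {k : ℕ} (σ : Equiv.Perm (Fin k)) {μ : ProbabilityMeasure Ω2}
    (hμ : μ ∈ Mcal) {δ : ℝ} (hG : Gfun σ (μ : Measure Ω2) δ ≠ ∞) {ε : ℝ} (hε : 0 < ε)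
    {ν : ProbabilityMeasure Ω2} (hν : ν ∈ Pcal) :
    ∃ U ∈ 𝓝 ν, ∃ c > (Gfun σ (μ : Measure Ω2) δ).toReal, ∀ n : ℕ, 0 < n →
      pmeas μ n (farSetIn σ μ δ ε U n) ≤ ENNReal.ofReal (Real.exp (-(n * c))) := by
  have hempty {U : Set (ProbabilityMeasure Ω2)}
      (h : ∀ n, 0 < n → farSetIn σ (μ : Measure Ω2) δ ε U n = ∅) :
      ∃ c > (Gfun σ (μ : Measure Ω2) δ).toReal, ∀ n : ℕ, 0 < n →
        pmeas μ n (farSetIn σ μ δ ε U n) ≤ ENNReal.ofReal (Real.exp (-(n * c))) :=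
    ⟨_, lt_add_one _, fun n hn => by simp [h n hn]⟩
  by_cases hKL : Gfun σ (μ : Measure Ω2) δ < KL ν μ
  · obtain ⟨c, hc1, hc2⟩ := ENNReal.lt_iff_exists_nnreal_btwn.1 hKL
    have hc2' : ENNReal.ofReal (c : ℝ) < KL ν μ := by rwa [ENNReal.ofReal_coe_nnreal]
    obtain ⟨U, hU, h⟩ := exists_mem_nhds_pmeas_emp_le hc2'
    refine ⟨U, hU, c, ?_, fun n hn => (measure_mono fun z hz => hz.2.2).trans (h n hn)⟩
    exact (ENNReal.toReal_lt_toReal hG ENNReal.coe_ne_top).2 hc1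
  · have hac : (ν : Measure Ω2) ≪ μ := by
      by_contra hac
      rw [KL, if_neg hac] at hKL
      exact hKL hG.lt_top
    have hνM := mem_Mcal_of_absolutelyContinuous hμ hν hac
    by_cases ht : tPat σ (ν : Measure Ω2) < δ
    · refine ⟨_, eventually_tPat_lt σ hνM ht, hempty fun n hn => ?_⟩
      refine Set.eq_empty_iff_forall_notMem.2 ?_
      rintro z ⟨hz, hgen, ν', hν', he⟩
      have h1 : tPat σ (ν' : Measure Ω2) < δ := hν'
      have h2 := hz.2
      rw [hgen.tPerm_eq hn, ← he] at h2
      exact absurd h1 (not_lt.2 h2)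
    · have hνG : ν ∈ Gset σ (μ : Measure Ω2) δ :=
        ⟨⟨hνM, not_lt.1 ht⟩, le_antisymm (not_lt.1 hKL)
          (iInf₂_le (f := fun (ν : ProbabilityMeasure Ω2) _ => KL (ν : Measure Ω2) μ) ν
            ⟨hνM, not_lt.1 ht⟩)⟩
      refine ⟨_, eventually_dLPE_Omap_lt hνM hε, hempty fun n hn => ?_⟩
      refine Set.eq_empty_iff_forall_notMem.2 ?_
      rintro z ⟨hz, hgen, ν', hν', he⟩
      have h1 : dLPE (Omap (ν' : Measure Ω2)) (Omap (ν : Measure Ω2)) < ENNReal.ofReal ε := hν'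
      have h2 := hz.1.trans (iInf₂_le ν hνG)
      rw [hgen.EmM_eq_Omap hn, ← he] at h2
      exact absurd h1 (not_lt.2 h2)

lemma exists_pmeas_farSet_le {k : ℕ} (σ : Equiv.Perm (Fin k)) {μ : ProbabilityMeasure Ω2}
    (hμ : μ ∈ Mcal) {δ : ℝ} (hG : Gfun σ (μ : Measure Ω2) δ ≠ ∞) {ε : ℝ} (hε : 0 < ε) :
    ∃ c > (Gfun σ (μ : Measure Ω2) δ).toReal, ∃ C : ℝ≥0∞, C ≠ ∞ ∧ ∀ n : ℕ, 0 < n →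
      pmeas μ n (farSet σ μ δ ε n) ≤ C * ENNReal.ofReal (Real.exp (-(n * c))) := by
  obtain ⟨c, hc, C, hC, h⟩ := isCompact_Pcal.induction_on
    (p := fun S => ∃ c > (Gfun σ (μ : Measure Ω2) δ).toReal, ∃ C : ℝ≥0∞, C ≠ ∞ ∧ ∀ n : ℕ, 0 < n →
      pmeas μ n (farSetIn σ μ δ ε S n) ≤ C * ENNReal.ofReal (Real.exp (-(n * c))))
    ⟨_, lt_add_one _, 0, ENNReal.zero_ne_top, fun n _ => by simp [farSetIn]⟩
    (by
      rintro S S' hS ⟨c, hc, C, hC, h⟩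
      refine ⟨c, hc, C, hC, fun n hn => (measure_mono ?_).trans (h n hn)⟩
      rintro z ⟨h1, h2, ν, h3, h4⟩
      exact ⟨h1, h2, ν, hS h3, h4⟩)
    (by
      rintro S S' ⟨c, hc, C, hC, h⟩ ⟨c', hc', C', hC', h'⟩
      refine ⟨min c c', lt_min hc hc', C + C', ENNReal.add_ne_top.2 ⟨hC, hC'⟩, fun n hn => ?_⟩
      have hexp {a : ℝ} (ha : min c c' ≤ a) :
          ENNReal.ofReal (Real.exp (-(n * a))) ≤ ENNReal.ofReal (Real.exp (-(n * min c c'))) := by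
        gcongr
      have hsub : farSetIn σ (μ : Measure Ω2) δ ε (S ∪ S') n ⊆
          farSetIn σ μ δ ε S n ∪ farSetIn σ μ δ ε S' n := by
        rintro z ⟨h1, h2, ν, h3 | h3, h4⟩
        · exact Or.inl ⟨h1, h2, ν, h3, h4⟩
        · exact Or.inr ⟨h1, h2, ν, h3, h4⟩
      refine (measure_mono hsub).trans ((measure_union_le _ _).trans ?_)
      rw [add_mul]
      exact add_le_add ((h n hn).trans (mul_le_mul_right (hexp (min_le_left _ _)) C))
        ((h' n hn).trans (mul_le_mul_right (hexp (min_le_right _ _)) C')))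
    (by
      intro ν hν
      obtain ⟨U, hU, c, hc, h⟩ := exists_mem_nhds_farSetIn_le σ hμ hG hε hν
      exact ⟨U, mem_nhdsWithin_of_mem_nhds hU, c, hc, 1, ENNReal.one_ne_top,
        fun n hn => by simpa using h n hn⟩)
  refine ⟨c, hc, C, hC, fun n hn => (measure_mono_ae ?_).trans (h n hn)⟩
  filter_upwards [ae_generic hμ n, ae_eval_pmeas (ae_mem_unitSq hμ.1) n] with z h1 h2 h3
  exact ⟨h3, h1, ⟨emp z, isProbabilityMeasure_emp hn z⟩, emp_unitSq hn h2, rfl⟩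

/-! ### The conditional law of large numbers -/

lemma KL_self (μ : Measure Ω2) [IsProbabilityMeasure μ] : KL μ μ = 0 := by
  rw [KL_eq_klDiv, InformationTheory.klDiv_self]

lemma Gfun_eq_zero_of_le_tPat {k : ℕ} (σ : Equiv.Perm (Fin k)) {μ : ProbabilityMeasure Ω2}
    (hμ : μ ∈ Mcal) {δ : ℝ} (hδ : δ ≤ tPat σ (μ : Measure Ω2)) :
    Gfun σ (μ : Measure Ω2) δ = 0 :=
  le_antisymm ((iInf₂_le (f := fun (ν : ProbabilityMeasure Ω2) _ => KL (ν : Measure Ω2) μ) μ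
    ⟨hμ, hδ⟩).trans_eq (KL_self _)) bot_le

lemma Gfun_ne_top_of_lt_alphaSig {k : ℕ} (σ : Equiv.Perm (Fin k)) {μ : ProbabilityMeasure Ω2}
    (hμ : μ ∈ Mcal) {δ : ℝ} (hδ : δ < alphaSig σ (μ : Measure Ω2)) :
    Gfun σ (μ : Measure Ω2) δ ≠ ∞ := fun h => by
  refine notMem_of_lt_csInf hδ ⟨tPat σ (μ : Measure Ω2), fun δ' htop => ?_⟩ h
  by_contra! hlt
  rw [Set.mem_ofPred_eq, Gfun_eq_zero_of_le_tPat σ hμ hlt.le] at htop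
  exact ENNReal.zero_ne_top htop

/-- The exponential lower bound for the probability of the conditioning event. -/
lemma exists_pmeas_tPerm_ge {k : ℕ} (σ : Equiv.Perm (Fin k)) {μ : ProbabilityMeasure Ω2}
    (hμ : μ ∈ Mcal) {δ : ℝ} (hδ0 : 0 ≤ δ) (hG : Gfun σ (μ : Measure Ω2) δ ≠ ∞)
    (hrc : ContinuousWithinAt (Gfun σ (μ : Measure Ω2)) (Set.Ici δ) δ) {c : ℝ}
    (hc : (Gfun σ (μ : Measure Ω2) δ).toReal < c) :
    ∃ p > 0, ∀ᶠ n : ℕ in atTop, ENNReal.ofReal (p * Real.exp (-(n * c))) ≤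
      pmeas μ n {z | δ ≤ tPerm σ (inducedPerm z)} := by
  have hlt := (ENNReal.lt_ofReal_iff_toReal_lt hG).2 hc
  obtain ⟨δ', hGδ', hδ'⟩ := (((hrc.mono Set.Ioi_subset_Ici_self).eventually
    (eventually_lt_nhds hlt)).and self_mem_nhdsWithin).exists
  simp only [Gfun, iInf_lt_iff, exists_prop] at hGδ'
  obtain ⟨ν, hν, hKL⟩ := hGδ'
  obtain ⟨p, hp, h⟩ := exists_pmeas_tPat_ge σ hδ0 ((Set.mem_Ioi.1 hδ').trans_le hν.2) hKL
  refine ⟨p, hp, ?_⟩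
  filter_upwards [h, eventually_gt_atTop 0] with n hn hn0
  refine hn.trans (measure_mono_ae ?_)
  filter_upwards [ae_generic hμ n] with z hz hz'
  exact hz'.trans_eq (hz.tPerm_eq hn0 σ).symm

/-- Theorem 1.14 (i): if `G(σ,μ,·)` is right-continuous at
`δ ∈ (t_σ(μ), α_σ(μ))`, then conditionally on `{t_σ(π_{n,μ}) ≥ δ}` the Lévy–Prokhorov
distance from `Em(π_{n,μ})` to `𝒪(𝒢(σ,μ,δ))` tends to `0` in probability. -/
theorem conditioned_convergence_to_minimizers {k : ℕ} (σ : Equiv.Perm (Fin k))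
    (μ : ProbabilityMeasure Ω2) (hμ : μ ∈ Mcal) (δ : ℝ)
    (hδ : δ ∈ Set.Ioo (tPat σ ((↑μ : Measure Ω2))) (alphaSig σ (↑μ)))
    (hrc : ContinuousWithinAt (Gfun σ ((↑μ : Measure Ω2))) (Set.Ici δ) δ) :
    ∀ ε > (0 : ℝ),
      Tendsto (fun n : ℕ =>
          pmeas (↑μ) n {z | ENNReal.ofReal ε ≤
              (⨅ ν ∈ Gset σ ((↑μ : Measure Ω2)) δ, dLPE (EmM (inducedPerm z)) (Omap ↑ν)) ∧
              δ ≤ tPerm σ (inducedPerm z)} /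
            pmeas (↑μ) n {z | δ ≤ tPerm σ (inducedPerm z)})
        atTop (𝓝 0) := by
  intro ε hε
  have hG := Gfun_ne_top_of_lt_alphaSig σ hμ hδ.2
  obtain ⟨c, hc, C, hC, hup⟩ := exists_pmeas_farSet_le σ hμ hG hε
  obtain ⟨c', hc', hcc'⟩ := exists_between hc
  obtain ⟨p, hp, hlow⟩ := exists_pmeas_tPerm_ge σ hμ ((tPat_nonneg σ _).trans hδ.1.le) hG hrc hc'
  have hlim : Tendsto (fun n : ℕ => C * ENNReal.ofReal (p⁻¹ * Real.exp (-(n * (c - c'))))) atTop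
      (𝓝 0) := by
    have h1 : Tendsto (fun n : ℕ => p⁻¹ * Real.exp (-(n * (c - c')))) atTop (𝓝 (p⁻¹ * 0)) :=
      (Real.tendsto_exp_neg_atTop_nhds_zero.comp
        (tendsto_natCast_atTop_atTop.atTop_mul_const (sub_pos.2 hcc'))).const_mul _
    have h2 := ENNReal.Tendsto.const_mul (a := C)
      ((ENNReal.continuous_ofReal.tendsto _).comp h1) (Or.inr hC)
    simpa using h2
  refine tendsto_of_tendsto_of_tendsto_of_le_of_le' tendsto_const_nhds hlim
    (.of_forall fun _ => bot_le) ?_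
  filter_upwards [hlow, eventually_gt_atTop 0] with n hn hn0
  refine (ENNReal.div_le_div (hup n hn0) hn).trans_eq ?_
  rw [mul_div_assoc, ← ENNReal.ofReal_div_of_pos (by positivity)]
  congr 2
  rw [show -((n : ℝ) * (c - c')) = -(n * c) - -(n * c') by ring, Real.exp_sub]
  field_simp

end
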